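/- arXiv:1103.2868 — 10 statements merged into one kernel-verified Lean document; each statement's English description precedes it below -/
import Mathlib

section
/- Let γ < 1, θ := 2^{γ−1}, and β > 0. Then the transcendental equation (1 + βμ)/2 = (1 − 2^{γ−1−μ})/(1 − θ) has exactly one solution μ > 0. Equivalently, with F(μ) := (1 − 2^{γ−1−μ})/(1 − θ), the function F satisfies F(0) = 1 > 1/2, F is strictly increasing on [0,∞) with lim_{μ→∞} F(μ) = 1/(1−θ), and the equation (1 + βμ)/2 = F(μ) has a unique positive root. -/
open Filter Topology Set

theorem aux_conv (c a b : ℝ) (ha : 0 < a) (hab : a < b) :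
    b * (2:ℝ) ^ (c - a) ≤ (b - a) * (2:ℝ) ^ c + a * (2:ℝ) ^ (c - b) := by
  have hb : 0 < b := ha.trans hab
  have h := convexOn_exp.2 (Set.mem_univ (Real.log 2 * c)) (Set.mem_univ (Real.log 2 * (c - b)))
    (show 0 ≤ (b - a) / b from div_nonneg (by linarith) hb.le) (show 0 ≤ a / b by positivity)
    (by field_simp; ring)
  simp only [smul_eq_mul] at h
  have e : (b - a) / b * (Real.log 2 * c) + a / b * (Real.log 2 * (c - b))
      = Real.log 2 * (c - a) := by
    field_simp; ring
  rw [e] at h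
  simp only [Real.rpow_def_of_pos (show (0:ℝ) < 2 by norm_num)]
  have h2 := mul_le_mul_of_nonneg_left h hb.le
  refine h2.trans (le_of_eq ?_)
  field_simp

theorem aux_uniq (c β a b : ℝ) (hθ : (2:ℝ) ^ c < 1) (ha : 0 < a) (hab : a < b)
    (h1 : (1 + β * a) / 2 = (1 - (2:ℝ) ^ (c - a)) / (1 - (2:ℝ) ^ c))
    (h2 : (1 + β * b) / 2 = (1 - (2:ℝ) ^ (c - b)) / (1 - (2:ℝ) ^ c)) : False := by
  have h := aux_conv c a b ha hab
  have hd : 0 < 1 - (2:ℝ) ^ c := by linarith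
  rw [eq_div_iff hd.ne'] at h1 h2
  have p : 0 < (b - a) * (1 - (2:ℝ) ^ c) := mul_pos (by linarith) hd
  have e1 : (2:ℝ) ^ (c - a) = 1 - (1 + β * a) / 2 * (1 - (2:ℝ) ^ c) := by linarith
  have e2 : (2:ℝ) ^ (c - b) = 1 - (1 + β * b) / 2 * (1 - (2:ℝ) ^ c) := by linarith
  rw [e1, e2] at h
  nlinarith

/-- Uniqueness of the exponent `μ`: with `θ = 2^(γ-1)` and
`F(μ) = (1 - 2^(γ-1-μ))/(1-θ)`, one has `F 0 = 1 > 1/2`, `F` is strictly increasing on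
`[0,∞)` with limit `1/(1-θ)` at infinity, and `(1 + βμ)/2 = F(μ)` has a unique positive
root. -/
theorem stmt1 (γ β : ℝ) (hγ : γ < 1) (hβ : 0 < β) :
    let θ : ℝ := (2:ℝ) ^ (γ - 1)
    let F : ℝ → ℝ := fun μ => (1 - (2:ℝ) ^ (γ - 1 - μ)) / (1 - θ)
    F 0 = 1 ∧ (1:ℝ)/2 < F 0 ∧ StrictMonoOn F (Set.Ici 0) ∧
      Tendsto F atTop (𝓝 (1 / (1 - θ))) ∧
      (∃! μ : ℝ, 0 < μ ∧ (1 + β * μ) / 2 = F μ) := by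
  intro θ F
  have hθ : θ < 1 := Real.rpow_lt_one_of_one_lt_of_neg (by norm_num) (by linarith)
  have hd : 0 < 1 - θ := by linarith
  have F0 : F 0 = 1 := by
    simp only [F, sub_zero]
    exact div_self hd.ne'
  have hcont : Continuous F := by
    have : Continuous fun μ : ℝ => (2:ℝ) ^ (γ - 1 - μ) :=
      (Real.continuous_const_rpow (by norm_num)).comp (by fun_prop)
    exact (continuous_const.sub this).div_const _
  refine ⟨F0, by rw [F0]; norm_num, ?_, ?_, ?_⟩
  · intro x _ y _ hxy
    have : (2:ℝ) ^ (γ - 1 - y) < (2:ℝ) ^ (γ - 1 - x) :=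
      Real.rpow_lt_rpow_of_exponent_lt (by norm_num) (by linarith)
    exact div_lt_div_of_pos_right (by linarith) hd
  · have h1 : Tendsto (fun μ : ℝ => (2:ℝ) ^ (γ - 1 - μ)) atTop (𝓝 0) := by
      refine (tendsto_rpow_atBot_of_base_gt_one 2 (by norm_num)).comp ?_
      exact tendsto_const_nhds.add_atBot tendsto_neg_atTop_atBot
    have h2 := ((tendsto_const_nhds (x := (1:ℝ))).sub h1).div_const (1 - θ)
    simpa [F] using h2
  · have hM : 0 < 2 / (β * (1 - θ)) := by positivity
    set M := 2 / (β * (1 - θ)) with hMdef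
    have hFM : F M < 1 / (1 - θ) := by
      have : 0 < (2:ℝ) ^ (γ - 1 - M) := by positivity
      exact div_lt_div_of_pos_right (by linarith) hd
    have hl : (1 + β * M) / 2 = 1 / 2 + 1 / (1 - θ) := by
      rw [hMdef]; field_simp
    have hg : ContinuousOn (fun μ => (1 + β * μ) / 2 - F μ) (Set.Icc 0 M) :=
      (Continuous.sub (by fun_prop) hcont).continuousOn
    obtain ⟨μ, hμ, hz⟩ := intermediate_value_Icc hM.le hg
      (show (0:ℝ) ∈ Set.Icc _ _ from ⟨by simp only [F0]; norm_num, by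
        simp only [hl]; linarith⟩)
    have hz' : (1 + β * μ) / 2 = F μ := sub_eq_zero.1 hz
    have hpos : 0 < μ := by
      rcases hμ.1.eq_or_lt with h | h
      · rw [← h, F0] at hz'; norm_num at hz'
      · exact h
    refine ⟨μ, ⟨hpos, hz'⟩, ?_⟩
    rintro ν ⟨hν, hνe⟩
    rcases lt_trichotomy ν μ with h | h | h
    · exact (aux_uniq (γ - 1) β ν μ hθ hν h hνe hz').elim
    · exact h
    · exact (aux_uniq (γ - 1) β μ ν hθ hpos h hz' hνe).elim
end

section
/- Let γ < 1, β > 0, β_* := 1/(1−γ), and let g : (0,∞) → (0,∞) be a C¹ solution of −(1 + (1+γ)β) g(x) − β x g'(x) = (1/4)(x/2)^{1+γ} g(x/2)² − x^{1+γ} g(x)² on (0,∞) such that x g(x) and x^{2+γ} g(x)² are integrable near 0 and lim_{x→0} x² g(x) = 0. Then g satisfies the integrated equation β x² g(x) = ∫_{x/2}^x s^{2+γ} g(s)² ds + (1−γ)(β − β_*) ∫_0^x s g(s) ds for all x > 0. -/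
open Filter Topology MeasureTheory Set

theorem prim_aux (f : ℝ → ℝ) (hc : ContinuousOn f (Ioi 0)) (hi : IntegrableOn f (Ioc 0 1)) :
    (∀ x > 0, IntervalIntegrable f volume 0 x) ∧
    (∀ x > 0, HasDerivAt (fun x => ∫ s in (0:ℝ)..x, f s) (f x) x) ∧
    Tendsto (fun x => ∫ s in (0:ℝ)..x, f s) (𝓝[>] 0) (𝓝 0) := by
  have h01 : IntervalIntegrable f volume 0 1 :=
    (intervalIntegrable_iff_integrableOn_Ioc_of_le zero_le_one).2 hi
  have hI : ∀ x > 0, IntervalIntegrable f volume 0 x := by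
    intro x hx
    refine h01.trans (ContinuousOn.intervalIntegrable (hc.mono ?_))
    intro y hy
    exact lt_of_lt_of_le (lt_min zero_lt_one hx) hy.1
  refine ⟨hI, ?_, ?_⟩
  · intro x hx
    exact intervalIntegral.integral_hasDerivAt_right (hI x hx)
      (hc.stronglyMeasurableAtFilter isOpen_Ioi x hx) (hc.continuousAt (Ioi_mem_nhds hx))
  · have h := intervalIntegral.continuousOn_primitive_interval (μ := volume) (f := f) (a := 0) (b := 1)
      (by rw [uIcc_of_le zero_le_one, integrableOn_Icc_iff_integrableOn_Ioc]; exact hi)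
    have h2 := h 0 left_mem_uIcc
    unfold ContinuousWithinAt at h2
    beta_reduce at h2
    rw [intervalIntegral.integral_same, uIcc_of_le zero_le_one] at h2
    refine h2.mono_left ?_
    rw [← nhdsWithin_Ioc_eq_nhdsGT (zero_lt_one : (0:ℝ) < 1)]
    exact nhdsWithin_mono _ Ioc_subset_Icc_self


/-- A positive `C¹` solution of the self-similar profile equation whose relevant
quantities are integrable near `0`, and with `x² g(x) → 0` as `x → 0`, satisfies the
integrated self-similar equation. -/
theorem stmt4 (γ β : ℝ) (hγ : γ < 1) (hβ : 0 < β) (g : ℝ → ℝ)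
    (hpos : ∀ x > 0, 0 < g x)
    (hg : ContDiffOn ℝ 1 g (Set.Ioi 0))
    (heq : ∀ x > 0, -(1 + (1 + γ) * β) * g x - β * x * deriv g x =
      (1/4) * (x/2) ^ (1 + γ) * (g (x/2)) ^ 2 - x ^ (1 + γ) * (g x) ^ 2)
    (hint1 : IntegrableOn (fun s => s * g s) (Set.Ioc 0 1))
    (hint2 : IntegrableOn (fun s => s ^ (2 + γ) * (g s) ^ 2) (Set.Ioc 0 1))
    (hlim : Tendsto (fun x => x ^ 2 * g x) (𝓝[>] 0) (𝓝 0)) :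
    ∀ x > 0, β * x ^ 2 * g x =
      (∫ s in (x/2)..x, s ^ (2 + γ) * (g s) ^ 2) +
        (1 - γ) * (β - 1 / (1 - γ)) * ∫ s in (0:ℝ)..x, s * g s := by
  have hgc : ContinuousOn g (Ioi 0) := hg.continuousOn
  have hgd : ∀ x > 0, HasDerivAt g (deriv g x) x := fun x hx =>
    ((hg.differentiableOn one_ne_zero).differentiableAt (Ioi_mem_nhds hx)).hasDerivAt
  have hc1 : ContinuousOn (fun s => s * g s) (Ioi 0) := continuousOn_id.mul hgc
  have hc2 : ContinuousOn (fun s => s ^ (2 + γ) * (g s) ^ 2) (Ioi 0) :=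
    (continuousOn_id.rpow_const (fun x hx => Or.inl (ne_of_gt hx))).mul (hgc.pow 2)
  obtain ⟨-, hd1, ht1⟩ := prim_aux _ hc1 hint1
  obtain ⟨hI2, hd2, ht2⟩ := prim_aux _ hc2 hint2
  set P : ℝ → ℝ := fun x => ∫ s in (0:ℝ)..x, s * g s with hP
  set Q : ℝ → ℝ := fun x => ∫ s in (0:ℝ)..x, s ^ (2 + γ) * (g s) ^ 2 with hQ
  set c : ℝ := (1 - γ) * (β - 1 / (1 - γ)) with hcdef
  have hcv : c = (1 - γ) * β - 1 := by
    have : 1 - γ ≠ 0 := by linarith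
    rw [hcdef]; field_simp
  set H : ℝ → ℝ := fun x => β * (x ^ 2 * g x) - (Q x - Q (x / 2)) - c * P x with hH
  have hHd : ∀ x > 0, HasDerivAt H 0 x := by
    intro x hx
    have hx2 : 0 < x / 2 := by linarith
    have e1 := (((hasDerivAt_pow 2 x).mul (hgd x hx)).const_mul β)
    have e2 := (hd2 (x / 2) hx2).comp x ((hasDerivAt_id x).div_const 2)
    have e3 := (e1.sub ((hd2 x hx).sub e2)).sub ((hd1 x hx).const_mul c)
    refine e3.congr_deriv ?_
    have r1 : x ^ (2 + γ) = x * x ^ (1 + γ) := by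
      rw [show 2 + γ = 1 + (1 + γ) by ring, Real.rpow_add hx, Real.rpow_one]
    have r2 : (x / 2) ^ (2 + γ) = x / 2 * (x / 2) ^ (1 + γ) := by
      rw [show 2 + γ = 1 + (1 + γ) by ring, Real.rpow_add hx2, Real.rpow_one]
    have := heq x hx
    simp only [r1, r2, hcv]
    push_cast
    linear_combination (-x) * this
  have hHt : Tendsto H (𝓝[>] 0) (𝓝 0) := by
    have hhalf : Tendsto (fun x : ℝ => x / 2) (𝓝[>] 0) (𝓝[>] 0) := by
      refine tendsto_nhdsWithin_iff.2 ⟨?_, ?_⟩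
      · have : Tendsto (fun x : ℝ => x / 2) (𝓝 0) (𝓝 (0 / 2)) :=
          (continuous_id.div_const 2).tendsto 0
        rw [zero_div] at this
        exact this.mono_left nhdsWithin_le_nhds
      · filter_upwards [self_mem_nhdsWithin] with x hx
        exact half_pos (mem_Ioi.1 hx)
    have := ((hlim.const_mul β).sub (ht2.sub (ht2.comp hhalf))).sub (ht1.const_mul c)
    simpa using this
  intro x hx
  have hconst : ∀ y > 0, H y = H x := by
    intro y hy
    refine isOpen_Ioi.is_const_of_deriv_eq_zero (s := Ioi (0:ℝ)) isPreconnected_Ioi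
      (fun z hz => (hHd z hz).differentiableAt.differentiableWithinAt)
      (fun z hz => (hHd z hz).deriv) hy hx
  have hHx : H x = 0 := by
    refine tendsto_nhds_unique (Tendsto.congr' ?_ tendsto_const_nhds) hHt
    filter_upwards [self_mem_nhdsWithin] with y hy
    exact (hconst y hy).symm
  have hs : (∫ s in (x/2)..x, s ^ (2 + γ) * (g s) ^ 2) = Q x - Q (x / 2) :=
    (intervalIntegral.integral_interval_sub_left (hI2 x hx) (hI2 (x/2) (half_pos hx))).symm
  rw [hs]
  change _ = _ + c * P x
  simp only [hH] at hHx
  linarith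
end

section
/- Let γ < 1, θ := 2^{γ−1}, β > 0, and let h be a differentiable solution of −β x h'(x) − h(x) = θ h(x/2)² − h(x)² on an interval (0,a). If the limit L := lim_{x→0} h(x) exists and L > 0, then L = 1/(1−θ). -/
open Filter Topology Set

/-- If `h` solves the rescaled profile equation on `(0,a)` and `h(x) → L > 0` as
`x → 0⁺`, then `L = 1/(1-θ)` with `θ = 2^(γ-1)`. -/
theorem stmt6 (γ β a L : ℝ) (hγ : γ < 1) (hβ : 0 < β) (ha : 0 < a) (h : ℝ → ℝ)
    (hdiff : ∀ x ∈ Set.Ioo (0:ℝ) a, DifferentiableAt ℝ h x)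
    (heq : ∀ x ∈ Set.Ioo (0:ℝ) a, -β * x * deriv h x - h x =
      (2:ℝ) ^ (γ - 1) * (h (x/2)) ^ 2 - (h x) ^ 2)
    (hlim : Tendsto h (𝓝[>] 0) (𝓝 L)) (hL : 0 < L) :
    L = 1 / (1 - (2:ℝ) ^ (γ - 1)) := by
  set θ : ℝ := (2:ℝ) ^ (γ - 1) with hθ
  have hθ1 : θ < 1 := Real.rpow_lt_one_of_one_lt_of_neg (by norm_num) (by linarith)
  have hmem : ∀ᶠ x in 𝓝[>] (0:ℝ), x ∈ Set.Ioo (0:ℝ) a := Ioo_mem_nhdsGT ha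
  have hhalf : Tendsto (fun x : ℝ => x / 2) (𝓝[>] 0) (𝓝[>] 0) := by
    refine tendsto_nhdsWithin_iff.2 ⟨?_, ?_⟩
    · have : Tendsto (fun x : ℝ => x / 2) (𝓝 0) (𝓝 (0 / 2)) :=
        (continuous_id.div_const 2).tendsto 0
      rw [zero_div] at this
      exact this.mono_left nhdsWithin_le_nhds
    · filter_upwards [hmem] with x hx
      exact half_pos hx.1
  have hlim2 : Tendsto (fun x => h (x / 2)) (𝓝[>] 0) (𝓝 L) := hlim.comp hhalf
  have hd : Tendsto (fun x => x * deriv h x) (𝓝[>] 0) (𝓝 ((L ^ 2 - L - θ * L ^ 2) / β)) := by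
    have h1 : Tendsto (fun x => ((h x) ^ 2 - h x - θ * (h (x / 2)) ^ 2) / β) (𝓝[>] 0)
        (𝓝 ((L ^ 2 - L - θ * L ^ 2) / β)) :=
      (((hlim.pow 2).sub hlim).sub ((hlim2.pow 2).const_mul θ)).div_const β
    refine h1.congr' ?_
    filter_upwards [hmem] with x hx
    rw [div_eq_iff hβ.ne']
    linarith [heq x hx]
  have hex : ∀ x, ∃ ξ, x ∈ Set.Ioo (0:ℝ) a →
      ξ ∈ Set.Ioo (x / 2) x ∧ deriv h ξ = (h x - h (x / 2)) / (x - x / 2) := by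
    intro x
    by_cases hx : x ∈ Set.Ioo (0:ℝ) a
    · have hx0 := hx.1
      have hxa := hx.2
      obtain ⟨ξ, h1, h2⟩ := exists_deriv_eq_slope h (a := x / 2) (b := x) (by linarith)
        (fun y hy => (hdiff y ⟨by linarith [hy.1], by linarith [hy.2]⟩).continuousAt.continuousWithinAt)
        (fun y hy => (hdiff y ⟨by linarith [hy.1], by linarith [hy.2]⟩).differentiableWithinAt)
      exact ⟨ξ, fun _ => ⟨h1, h2⟩⟩
    · exact ⟨0, fun h => absurd h hx⟩
  choose ξ hξ using hex
  have hξlim : Tendsto ξ (𝓝[>] 0) (𝓝[>] 0) := by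
    refine tendsto_nhdsWithin_iff.2 ⟨?_, ?_⟩
    · refine tendsto_of_tendsto_of_tendsto_of_le_of_le' (hhalf.mono_right nhdsWithin_le_nhds)
        (tendsto_id.mono_left nhdsWithin_le_nhds) ?_ ?_
      · filter_upwards [hmem] with x hx using (hξ x hx).1.1.le
      · filter_upwards [hmem] with x hx using (hξ x hx).1.2.le
    · filter_upwards [hmem] with x hx
      exact (half_pos hx.1).trans (hξ x hx).1.1
  have hc := hd.comp hξlim
  have hz : Tendsto ((fun x => x * deriv h x) ∘ ξ) (𝓝[>] 0) (𝓝 0) := by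
    have h2 : Tendsto (fun x => 2 * |h x - h (x / 2)|) (𝓝[>] 0) (𝓝 0) := by
      simpa using ((hlim.sub hlim2).abs).const_mul 2
    refine squeeze_zero_norm' ?_ h2
    filter_upwards [hmem] with x hx
    obtain ⟨⟨h3, h4⟩, h5⟩ := hξ x hx
    have hx0 := hx.1
    have e : h x - h (x / 2) = deriv h (ξ x) * (x / 2) := by
      rw [h5]; field_simp; ring
    have hp : 0 < ξ x := by linarith
    simp only [Function.comp, Real.norm_eq_abs]
    rw [e, abs_mul, abs_mul, abs_of_pos hp, abs_of_pos (half_pos hx0)]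
    nlinarith [abs_nonneg (deriv h (ξ x))]
  have h0 := tendsto_nhds_unique hc hz
  rw [div_eq_zero_iff] at h0
  have h1 : L ^ 2 - L - θ * L ^ 2 = 0 := h0.resolve_right hβ.ne'
  rw [eq_div_iff (by linarith)]
  apply mul_left_cancel₀ hL.ne'
  linarith
end

section
/- Let γ < 1, β ≥ β_* := 1/(1−γ), θ := 2^{γ−1}, let μ > 0 be the unique positive solution of (1 + βμ)/2 = (1 − 2^{γ−1−μ})/(1 − θ), let c ∈ ℝ, and fix ε ∈ (0, μ). Then there exist z > 0 and a continuous function j : [0,z] → ℝ with j(0) = 0 and sup_{x∈(0,z]} x^{−ε}|j(x)| < ∞ such that j = T[j] on [0,z], where T[j](x) := (1/β) x^{−(1−γ+μ)} ( ∫_{x/2}^x s^{−γ+μ} (2/(1−θ)) j(s) ds + ∫_{x/2}^x s^{−γ+2μ} (−c + j(s))² ds + (1−γ)(β − β_*) ∫_0^x s^{−γ+μ} j(s) ds ). Consequently, h(x) := 1/(1−θ) + x^{μ}(−c + j(x)) satisfies β x^{1−γ} h(x) = ∫_{x/2}^x s^{−γ} h(s)² ds + (1−γ)(β − β_*) ∫_0^x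 s^{−γ} h(s) ds for all x ∈ (0,z], and h(x) = 1/(1−θ) − c x^{μ} + o(x^{μ}) as x → 0. -/
open Filter Topology MeasureTheory Set

lemma aux_ii (e l : ℝ) (he : -1 < e) : IntervalIntegrable (fun t : ℝ => t ^ e) volume l 1 :=
  intervalIntegral.intervalIntegrable_rpow' he

lemma aux_bound (e l M : ℝ) (he : -1 < e) (hl : 0 ≤ l) (hl1 : l ≤ 1) (G : ℝ → ℝ)
    (hG : ∀ t ∈ Ioc l 1, |G t| ≤ M) :
    |∫ t in l..1, t ^ e * G t| ≤ M * ∫ t in l..1, t ^ e := by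
  rw [← intervalIntegral.integral_const_mul, ← Real.norm_eq_abs]
  refine intervalIntegral.norm_integral_le_of_norm_le hl1 ?_ ((aux_ii e l he).const_mul M)
  refine ae_of_all _ fun t ht => ?_
  have h0 : 0 ≤ t ^ e := Real.rpow_nonneg (hl.trans ht.1.le) e
  rw [Real.norm_eq_abs, abs_mul, abs_of_nonneg h0, mul_comm]
  exact mul_le_mul_of_nonneg_right (hG t ht) h0

lemma aux_cont (e l M : ℝ) (he : -1 < e) (hl : 0 ≤ l) (hl1 : l ≤ 1) (G : ℝ → ℝ → ℝ)
    (hc : Continuous (fun q : ℝ × ℝ => G q.1 q.2))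
    (hG : ∀ x, ∀ t ∈ Ioc l 1, |G x t| ≤ M) :
    Continuous (fun x => ∫ t in l..1, t ^ e * G x t) := by
  refine intervalIntegral.continuous_of_dominated_interval (bound := fun t => M * t ^ e) ?_ ?_
    ((aux_ii e l he).const_mul M) ?_
  · intro x
    refine AEStronglyMeasurable.mul ?_ ?_
    · exact (Measurable.pow_const measurable_id e).aestronglyMeasurable
    · exact (by fun_prop : Continuous (fun t => G x t)).aestronglyMeasurable
  · intro x
    refine ae_of_all _ fun t ht => ?_
    rw [uIoc_of_le hl1] at ht
    have h0 : 0 ≤ t ^ e := Real.rpow_nonneg (hl.trans ht.1.le) e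
    rw [Real.norm_eq_abs, abs_mul, abs_of_nonneg h0, mul_comm]
    exact mul_le_mul_of_nonneg_right (hG x t ht) h0
  · refine ae_of_all _ fun t _ => ?_
    exact continuous_const.mul (by fun_prop)

lemma aux_nonneg (e l : ℝ) (hl : 0 ≤ l) (hl1 : l ≤ 1) : 0 ≤ ∫ t in l..1, (t:ℝ) ^ e :=
  intervalIntegral.integral_nonneg hl1 fun t ht => Real.rpow_nonneg (hl.trans ht.1) e

lemma aux_fix (e e2 a b k c ε δ : ℝ) (he : -1 < e) (he2 : -1 < e2) (ha : 0 ≤ a) (hb : 0 ≤ b)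
    (hk : 0 ≤ k) (hε : 0 < ε) (hδ : 0 < δ)
    (hκ : a * (∫ t in (1/2:ℝ)..1, (t:ℝ) ^ e) + b * (∫ t in (0:ℝ)..1, (t:ℝ) ^ e) < 1) :
    ∃ z > 0, ∃ g : BoundedContinuousFunction ℝ ℝ, ∀ x ∈ Icc 0 z,
      g x = a * (∫ t in (1/2:ℝ)..1, t ^ e * g (x * t)) + b * (∫ t in (0:ℝ)..1, t ^ e * g (x * t))
        + k * x ^ δ * ∫ t in (1/2:ℝ)..1, t ^ e2 * (-c + (x * t) ^ ε * g (x * t)) ^ 2 := by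
  set I1 := ∫ t in (1/2:ℝ)..1, (t:ℝ) ^ e with hI1
  set I0 := ∫ t in (0:ℝ)..1, (t:ℝ) ^ e with hI0
  set K := ∫ t in (1/2:ℝ)..1, (t:ℝ) ^ e2 with hK
  have hI1n : 0 ≤ I1 := aux_nonneg e _ (by norm_num) (by norm_num)
  have hI0n : 0 ≤ I0 := aux_nonneg e _ (by norm_num) (by norm_num)
  have hKn : 0 ≤ K := aux_nonneg e2 _ (by norm_num) (by norm_num)
  set κ := a * I1 + b * I0 with hκd
  have hκn : 0 ≤ κ := by positivity
  -- choose z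
  obtain ⟨z, hz, hz1, hzq⟩ : ∃ z > 0, z ≤ 1 ∧
      k * z ^ δ * (2 * (|c| + 1) ^ 2 * K) ≤ (1 - κ) / 2 := by
    have hc : Continuous fun z : ℝ => k * z ^ δ * (2 * (|c| + 1) ^ 2 * K) :=
      (continuous_const.mul (Real.continuous_rpow_const hδ.le)).mul continuous_const
    have h1 : ∀ᶠ z in 𝓝 (0:ℝ), k * z ^ δ * (2 * (|c| + 1) ^ 2 * K) < (1 - κ) / 2 := by
      refine hc.continuousAt.eventually_lt continuousAt_const ?_
      simp only [Real.zero_rpow hδ.ne']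
      linarith
    have h2 : ∀ᶠ z in 𝓝[>] (0:ℝ), (k * z ^ δ * (2 * (|c| + 1) ^ 2 * K) < (1 - κ) / 2) ∧
        z < 1 ∧ 0 < z :=
      (h1.filter_mono nhdsWithin_le_nhds).and
        (((eventually_lt_nhds one_pos).filter_mono nhdsWithin_le_nhds).and self_mem_nhdsWithin)
    obtain ⟨z, h, h', h''⟩ := h2.exists
    exact ⟨z, h'', h'.le, h.le⟩
  set p : ℝ → ℝ := fun x => max 0 (min x z) with hp
  have hpc : Continuous p := by fun_prop
  have hp0 : ∀ x, 0 ≤ p x := fun x => le_max_left _ _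
  have hpz : ∀ x, p x ≤ z := fun x => max_le hz.le (min_le_right _ _)
  have hrp : Continuous fun x : ℝ => x ^ ε := Real.continuous_rpow_const hε.le
  have hrd : Continuous fun x : ℝ => x ^ δ := Real.continuous_rpow_const hδ.le
  have hrb : ∀ x, ∀ t ∈ Ioc (1/2:ℝ) 1, 0 ≤ (p x * t) ^ ε ∧ (p x * t) ^ ε ≤ 1 := by
    intro x t ht
    have ht0 : 0 ≤ t := by linarith [ht.1]
    have h0 := mul_nonneg (hp0 x) ht0
    exact ⟨Real.rpow_nonneg h0 _, Real.rpow_le_one h0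
      (mul_le_one₀ ((hpz x).trans hz1) ht0 ht.2) hε.le⟩
  have hqx : ∀ x, 0 ≤ (p x) ^ δ ∧ (p x) ^ δ ≤ z ^ δ := fun x =>
    ⟨Real.rpow_nonneg (hp0 x) _, Real.rpow_le_rpow (hp0 x) (hpz x) hδ.le⟩
  have hgb : ∀ (g : BoundedContinuousFunction ℝ ℝ) y, |g y| ≤ ‖g‖ := fun g y => g.norm_coe_le_norm y
  have hu : ∀ (g : BoundedContinuousFunction ℝ ℝ) x, ∀ t ∈ Ioc (1/2:ℝ) 1,
      |-c + (p x * t) ^ ε * g (p x * t)| ≤ |c| + ‖g‖ := by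
    intro g x t ht
    obtain ⟨h0, h1⟩ := hrb x t ht
    refine (abs_add_le _ _).trans ?_
    rw [abs_neg, abs_mul, abs_of_nonneg h0]
    have := mul_le_mul h1 (hgb g (p x * t)) (abs_nonneg _) zero_le_one
    linarith
  have hu2 : ∀ (g : BoundedContinuousFunction ℝ ℝ) x, ∀ t ∈ Ioc (1/2:ℝ) 1,
      |(-c + (p x * t) ^ ε * g (p x * t)) ^ 2| ≤ (|c| + ‖g‖) ^ 2 := by
    intro g x t ht
    rw [abs_pow]
    exact pow_le_pow_left₀ (abs_nonneg _) (hu g x t ht) 2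
  have hQc : ∀ (g : BoundedContinuousFunction ℝ ℝ), Continuous fun q : ℝ × ℝ =>
      (-c + (p q.1 * q.2) ^ ε * g (p q.1 * q.2)) ^ 2 := by
    intro g
    have h1 : Continuous fun q : ℝ × ℝ => p q.1 * q.2 := by fun_prop
    exact (continuous_const.add ((hrp.comp h1).mul (g.continuous.comp h1))).pow 2
  have hLc : ∀ (g : BoundedContinuousFunction ℝ ℝ), Continuous fun q : ℝ × ℝ =>
      g (p q.1 * q.2) := by
    intro g
    have h1 : Continuous fun q : ℝ × ℝ => p q.1 * q.2 := by fun_prop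
    exact g.continuous.comp h1
  set F : BoundedContinuousFunction ℝ ℝ → ℝ → ℝ := fun g x =>
    a * (∫ t in (1/2:ℝ)..1, t ^ e * g (p x * t)) + b * (∫ t in (0:ℝ)..1, t ^ e * g (p x * t))
        + k * (p x) ^ δ * ∫ t in (1/2:ℝ)..1, t ^ e2 * (-c + (p x * t) ^ ε * g (p x * t)) ^ 2 with hF
  have hFc : ∀ g, Continuous (F g) := by
    intro g
    have h1 := aux_cont e (1/2) ‖g‖ he (by norm_num) (by norm_num) (fun x t => g (p x * t))
      (hLc g) (fun x t _ => hgb g _)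
    have h2 := aux_cont e 0 ‖g‖ he (by norm_num) (by norm_num) (fun x t => g (p x * t))
      (hLc g) (fun x t _ => hgb g _)
    have h3 := aux_cont e2 (1/2) _ he2 (by norm_num) (by norm_num) _ (hQc g) (hu2 g)
    exact ((continuous_const.mul h1).add (continuous_const.mul h2)).add
      ((continuous_const.mul (hrd.comp hpc)).mul h3)
  have hFb : ∀ g x, |F g x| ≤ κ * ‖g‖ + k * z ^ δ * ((|c| + ‖g‖) ^ 2 * K) := by
    intro g x
    have h1 := aux_bound e (1/2) ‖g‖ he (by norm_num) (by norm_num) (fun t => g (p x * t))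
      (fun t _ => hgb g _)
    have h2 := aux_bound e 0 ‖g‖ he (by norm_num) (by norm_num) (fun t => g (p x * t))
      (fun t _ => hgb g _)
    have h3 := aux_bound e2 (1/2) _ he2 (by norm_num) (by norm_num) _ (hu2 g x)
    refine (abs_add_le _ _).trans (add_le_add ((abs_add_le _ _).trans ?_) ?_)
    · rw [abs_mul, abs_mul, abs_of_nonneg ha, abs_of_nonneg hb]
      have := mul_le_mul_of_nonneg_left h1 ha
      have := mul_le_mul_of_nonneg_left h2 hb
      rw [hκd]
      linarith
    · rw [abs_mul, abs_of_nonneg (mul_nonneg hk (hqx x).1)]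
      exact mul_le_mul (mul_le_mul_of_nonneg_left (hqx x).2 hk) h3 (abs_nonneg _)
        (mul_nonneg hk ((hqx x).1.trans (hqx x).2))
  set S : BoundedContinuousFunction ℝ ℝ → BoundedContinuousFunction ℝ ℝ := fun g =>
    BoundedContinuousFunction.ofNormedAddCommGroup (F g) (hFc g) _ (hFb g) with hS
  have hzd : 0 ≤ z ^ δ := Real.rpow_nonneg hz.le _
  have hmaps : MapsTo S (Metric.closedBall 0 1) (Metric.closedBall 0 1) := by
    intro g hg
    rw [mem_closedBall_zero_iff] at hg ⊢
    rw [BoundedContinuousFunction.norm_le zero_le_one]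
    intro x
    refine (hFb g x).trans ?_
    have h1 : (|c| + ‖g‖) ^ 2 ≤ (|c| + 1) ^ 2 := by gcongr
    have h2 : k * z ^ δ * ((|c| + ‖g‖) ^ 2 * K) ≤ k * z ^ δ * ((2 * (|c| + 1) ^ 2) * K) := by
      have := sq_nonneg (|c| + 1)
      gcongr
      linarith
    have h3 : κ * ‖g‖ ≤ κ * 1 := by gcongr
    linarith
  have hlip : ∀ g1 ∈ Metric.closedBall (0 : BoundedContinuousFunction ℝ ℝ) 1,
      ∀ g2 ∈ Metric.closedBall (0 : BoundedContinuousFunction ℝ ℝ) 1,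
      dist (S g1) (S g2) ≤ ((1 + κ) / 2) * dist g1 g2 := by
    intro g1 hg1 g2 hg2
    rw [mem_closedBall_zero_iff] at hg1 hg2
    rw [BoundedContinuousFunction.dist_le (by positivity)]
    intro x
    set D := dist g1 g2 with hD
    have hD0 : 0 ≤ D := dist_nonneg
    have hd : ∀ y, |g1 y - g2 y| ≤ D := fun y => by
      rw [← Real.dist_eq]; exact BoundedContinuousFunction.dist_coe_le_dist y
    have hint : ∀ (g : BoundedContinuousFunction ℝ ℝ) (l : ℝ),
        IntervalIntegrable (fun t => t ^ e * g (p x * t)) volume l 1 := by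
      intro g l
      exact (aux_ii e l he).mul_continuousOn
        (by have := hLc g; fun_prop)
    have hint2 : ∀ (g : BoundedContinuousFunction ℝ ℝ),
        IntervalIntegrable (fun t => t ^ e2 * (-c + (p x * t) ^ ε * g (p x * t)) ^ 2)
          volume (1/2) 1 := by
      intro g
      refine (aux_ii e2 _ he2).mul_continuousOn (Continuous.continuousOn ?_)
      exact (hQc g).comp (by fun_prop : Continuous fun t : ℝ => (x, t))
    have e1 : ∀ l, (∫ t in l..1, t ^ e * g1 (p x * t)) - (∫ t in l..1, t ^ e * g2 (p x * t))
        = ∫ t in l..1, t ^ e * (g1 (p x * t) - g2 (p x * t)) := by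
      intro l
      rw [← intervalIntegral.integral_sub (hint g1 l) (hint g2 l)]
      simp only [mul_sub]
    have e3 := intervalIntegral.integral_sub (hint2 g1) (hint2 g2)
    simp only [← mul_sub] at e3
    have h1 := aux_bound e (1/2) D he (by norm_num) (by norm_num)
      (fun t => g1 (p x * t) - g2 (p x * t)) (fun t _ => hd _)
    have h2 := aux_bound e 0 D he (by norm_num) (by norm_num)
      (fun t => g1 (p x * t) - g2 (p x * t)) (fun t _ => hd _)
    have h3 := aux_bound e2 (1/2) (2 * (|c| + 1) ^ 2 * D) he2 (by norm_num) (by norm_num)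
      (fun t => (-c + (p x * t) ^ ε * g1 (p x * t)) ^ 2 - (-c + (p x * t) ^ ε * g2 (p x * t)) ^ 2)
      (by
        intro t ht
        obtain ⟨q0, q1⟩ := hrb x t ht
        have u1 := hu g1 x t ht
        have u2 := hu g2 x t ht
        have : (-c + (p x * t) ^ ε * g1 (p x * t)) ^ 2 - (-c + (p x * t) ^ ε * g2 (p x * t)) ^ 2
          = ((-c + (p x * t) ^ ε * g1 (p x * t)) + (-c + (p x * t) ^ ε * g2 (p x * t))) *
            ((p x * t) ^ ε * (g1 (p x * t) - g2 (p x * t))) := by ring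
        rw [this, abs_mul, abs_mul _ (g1 _ - g2 _), abs_of_nonneg q0]
        have v1 := mul_le_mul q1 (hd (p x * t)) (abs_nonneg _) zero_le_one
        have v2 : |(-c + (p x * t) ^ ε * g1 (p x * t)) + (-c + (p x * t) ^ ε * g2 (p x * t))|
            ≤ 2 * (|c| + 1) ^ 2 := by
          refine (abs_add_le _ _).trans ?_
          nlinarith [abs_nonneg c]
        have v3 := mul_le_mul v2 v1 (mul_nonneg q0 (abs_nonneg _)) (by positivity)
        linarith)
    rw [← e1, ← hI1] at h1
    rw [← e1, ← hI0] at h2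
    rw [e3, ← hK] at h3
    change |F g1 x - F g2 x| ≤ _
    have hsplit : F g1 x - F g2 x = a * ((∫ t in (1/2:ℝ)..1, t ^ e * g1 (p x * t)) - (∫ t in (1/2:ℝ)..1, t ^ e * g2 (p x * t)))
      + b * ((∫ t in (0:ℝ)..1, t ^ e * g1 (p x * t)) - (∫ t in (0:ℝ)..1, t ^ e * g2 (p x * t)))
      + k * (p x) ^ δ * ((∫ t in (1/2:ℝ)..1, t ^ e2 * (-c + (p x * t) ^ ε * g1 (p x * t)) ^ 2)
        - ∫ t in (1/2:ℝ)..1, t ^ e2 * (-c + (p x * t) ^ ε * g2 (p x * t)) ^ 2) := by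
      simp only [hF]; ring
    rw [hsplit]
    have w1 := mul_le_mul_of_nonneg_left h1 ha
    have w2 := mul_le_mul_of_nonneg_left h2 hb
    have w3 := mul_le_mul (mul_le_mul_of_nonneg_left (hqx x).2 hk) h3 (abs_nonneg _)
        (mul_nonneg hk ((hqx x).1.trans (hqx x).2))
    have w4 := mul_le_mul_of_nonneg_right hzq hD0
    refine (abs_add_le _ _).trans ((add_le_add (abs_add_le _ _) le_rfl).trans ?_)
    rw [abs_mul, abs_mul b, abs_mul (k * _), abs_of_nonneg ha, abs_of_nonneg hb,
      abs_of_nonneg (mul_nonneg hk (hqx x).1)]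
    have : (1 + κ) / 2 * D = a * (D * I1) + b * (D * I0) + (1 - κ) / 2 * D := by
      rw [hκd]; ring
    rw [this]
    refine add_le_add (add_le_add w1 w2) (w3.trans ?_)
    linarith
  have hcomp : IsComplete (Metric.closedBall (0 : BoundedContinuousFunction ℝ ℝ) 1) :=
    Metric.isClosed_closedBall.isComplete
  have hcw : ContractingWith (Real.toNNReal ((1 + κ) / 2)) (hmaps.restrict S _ _) := by
    constructor
    · rw [Real.toNNReal_lt_one]; linarith
    · refine LipschitzWith.of_dist_le_mul fun g1 g2 => ?_
      rw [Real.coe_toNNReal _ (by positivity)]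
      exact hlip g1 g1.2 g2 g2.2
  obtain ⟨g, -, hfix, -⟩ := hcw.exists_fixedPoint' hcomp hmaps
    (x := 0) (by simp) (edist_ne_top _ _)
  refine ⟨z, hz, g, fun x hx => ?_⟩
  have hpx : p x = x := by simp [hp, hx.1, hx.2]
  have h := congrArg (fun G : BoundedContinuousFunction ℝ ℝ => G x) hfix
  change F g x = g x at h
  rw [← h]
  simp only [hF, hpx]

lemma aux_subst (r l x : ℝ) (hl : 0 ≤ l) (hl1 : l ≤ 1) (hx : 0 < x) (G : ℝ → ℝ) :
    ∫ s in (x * l)..x, s ^ r * G s = x ^ (r + 1) * ∫ t in l..1, t ^ r * G (x * t) := by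
  have h := intervalIntegral.mul_integral_comp_mul_left (a := l) (b := 1)
    (f := fun s => s ^ r * G s) (c := x)
  rw [mul_one] at h
  rw [← h, Real.rpow_add_one hx.ne', mul_comm (x ^ r), mul_assoc]
  congr 1
  rw [← intervalIntegral.integral_const_mul]
  refine intervalIntegral.integral_congr fun t ht => ?_
  rw [uIcc_of_le hl1] at ht
  rw [Real.mul_rpow hx.le (hl.trans ht.1)]
  ring

lemma aux_kappa (γ β μ ε : ℝ) (hγ : γ < 1) (hβ0 : 0 < β) (hμpos : 0 < μ)
    (hμ : (1 + β * μ) / 2 = (1 - (2:ℝ) ^ (γ - 1 - μ)) / (1 - (2:ℝ) ^ (γ - 1)))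
    (hε : 0 < ε) (hθ1 : (2:ℝ) ^ (γ - 1) < 1) :
    (1/β) * (2 / (1 - (2:ℝ) ^ (γ - 1))) * (∫ t in (1/2:ℝ)..1, (t:ℝ) ^ (-γ + μ + ε))
     + (1/β) * ((1 - γ) * (β - 1 / (1 - γ))) * (∫ t in (0:ℝ)..1, (t:ℝ) ^ (-γ + μ + ε)) < 1 := by
  have hn : -γ + μ + ε + 1 = 1 - γ + μ + ε := by ring
  have hpos : 0 < 1 - γ + μ + ε := by linarith
  rw [integral_rpow (Or.inl (by linarith)), integral_rpow (Or.inl (by linarith)), hn,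
    Real.one_rpow, Real.zero_rpow hpos.ne', one_div (2:ℝ), Real.inv_rpow (by norm_num),
    ← Real.rpow_neg (by norm_num)]
  have e1 : -(1 - γ + μ + ε) = (γ - 1) + -(μ + ε) := by ring
  have e2 : γ - 1 - μ = (γ - 1) + -μ := by ring
  rw [e2, Real.rpow_add two_pos] at hμ
  rw [e1, Real.rpow_add two_pos]
  have hθ0 : 0 < (2:ℝ) ^ (γ - 1) := by positivity
  set θ := (2:ℝ) ^ (γ - 1)
  have hconv : (μ + ε) * (2:ℝ) ^ (-μ) ≤ ε + μ * (2:ℝ) ^ (-(μ + ε)) := by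
    have h := convexOn_exp.2 (mem_univ 0) (mem_univ (Real.log 2 * -(μ + ε)))
      (by positivity : 0 ≤ ε / (μ + ε)) (by positivity : 0 ≤ μ / (μ + ε)) (by field_simp; ring)
    have h5 : μ / (μ + ε) * (Real.log 2 * -(μ + ε)) = Real.log 2 * -μ := by field_simp
    simp only [smul_eq_mul, mul_zero, zero_add, Real.exp_zero, mul_one, h5] at h
    rw [← Real.rpow_def_of_pos two_pos, ← Real.rpow_def_of_pos two_pos] at h
    have h2 := mul_le_mul_of_nonneg_left h (by positivity : 0 ≤ μ + ε)
    refine h2.trans (le_of_eq ?_)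
    field_simp
  set y := (2:ℝ) ^ (-μ)
  set w := (2:ℝ) ^ (-(μ + ε))
  have h1θ : 0 < 1 - θ := by linarith
  have h1γ : 0 < 1 - γ := by linarith
  have hμ2 : (1 + β * μ) * (1 - θ) = 2 * (1 - θ * y) := by
    field_simp at hμ; linarith
  have key : 2 * (1 - θ * w) < (1 - θ) * (1 + β * (μ + ε)) := by
    have h1 := mul_le_mul_of_nonneg_left hconv hθ0.le
    have h2 : μ * (2 * (1 - θ * w)) < μ * ((1 - θ) * (1 + β * (μ + ε))) := by
      have h3 : μ * (2 * (1 - θ * w)) ≤ (μ + ε) * (2 * (1 - θ * y)) - 2 * ε * (1 - θ) := by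
        linarith
      rw [← hμ2] at h3
      have := mul_pos hε h1θ
      nlinarith
    exact lt_of_mul_lt_mul_left h2 hμpos.le
  have hfin : 2 / (1 - θ) * (1 - θ * w) < 1 + β * (μ + ε) := by
    rw [div_mul_eq_mul_div, div_lt_iff₀ h1θ]; linarith
  have hE : 1 / β * (2 / (1 - θ)) * ((1 - θ * w) / (1 - γ + μ + ε)) +
      1 / β * ((1 - γ) * (β - 1 / (1 - γ))) * ((1 - 0) / (1 - γ + μ + ε)) =
      (2 / (1 - θ) * (1 - θ * w) + ((1 - γ) * β - 1)) / (β * (1 - γ + μ + ε)) := by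
    field_simp
    ring
  rw [hE, div_lt_one (by positivity)]
  linarith

/-- Local existence of a fixed point `j = T[j]` in the weighted space `C_ε(z)`, and the
resulting local solution `h(x) = 1/(1-θ) + x^μ(-c + j(x))` of the integrated rescaled
equation, with the expansion `h(x) = 1/(1-θ) - c x^μ + o(x^μ)` as `x → 0`. -/
theorem stmt8 (γ β μ c ε : ℝ) (hγ : γ < 1) (hβ : 1 / (1 - γ) ≤ β)
    (hμpos : 0 < μ)
    (hμ : (1 + β * μ) / 2 = (1 - (2:ℝ) ^ (γ - 1 - μ)) / (1 - (2:ℝ) ^ (γ - 1)))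
    (hε : ε ∈ Set.Ioo 0 μ) :
    let θ : ℝ := (2:ℝ) ^ (γ - 1)
    let T : (ℝ → ℝ) → ℝ → ℝ := fun j x =>
      (1/β) * x ^ (-(1 - γ + μ)) *
        ((∫ s in (x/2)..x, s ^ (-γ + μ) * (2 / (1 - θ)) * j s) +
         (∫ s in (x/2)..x, s ^ (-γ + 2*μ) * (-c + j s) ^ 2) +
         (1 - γ) * (β - 1 / (1 - γ)) * ∫ s in (0:ℝ)..x, s ^ (-γ + μ) * j s)
    ∃ z > 0, ∃ j : ℝ → ℝ,
      ContinuousOn j (Set.Icc 0 z) ∧ j 0 = 0 ∧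
      (∃ M : ℝ, ∀ x ∈ Set.Ioc 0 z, |j x| ≤ M * x ^ ε) ∧
      (∀ x ∈ Set.Icc 0 z, j x = T j x) ∧
      (let h : ℝ → ℝ := fun x => 1 / (1 - θ) + x ^ μ * (-c + j x)
       (∀ x ∈ Set.Ioc 0 z, β * x ^ (1 - γ) * h x =
          (∫ s in (x/2)..x, s ^ (-γ) * (h s) ^ 2) +
            (1 - γ) * (β - 1 / (1 - γ)) * ∫ s in (0:ℝ)..x, s ^ (-γ) * h s) ∧
       Asymptotics.IsLittleO (𝓝[>] 0)
         (fun x => h x - (1 / (1 - θ) - c * x ^ μ)) (fun x => x ^ μ)) := by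
  intro θ T
  have h1γ : 0 < 1 - γ := by linarith
  have hβ0 : 0 < β := lt_of_lt_of_le (by positivity) hβ
  have hθ1 : θ < 1 := Real.rpow_lt_one_of_one_lt_of_neg one_lt_two (by linarith)
  have h1θ : 0 < 1 - θ := by linarith
  obtain ⟨hε0, hεμ⟩ := hε
  have hC0 : 0 ≤ (1 - γ) * (β - 1 / (1 - γ)) := mul_nonneg h1γ.le (by linarith)
  obtain ⟨z, hz, g, hg⟩ := aux_fix (-γ + μ + ε) (-γ + 2 * μ) ((1/β) * (2 / (1 - θ)))
    ((1/β) * ((1 - γ) * (β - 1 / (1 - γ)))) (1/β) c ε (μ - ε) (by linarith) (by linarith)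
    (by positivity) (by positivity) (by positivity) hε0 (by linarith)
    (aux_kappa γ β μ ε hγ hβ0 hμpos hμ hε0 hθ1)
  set C := (1 - γ) * (β - 1 / (1 - γ)) with hC
  set j : ℝ → ℝ := fun x => x ^ ε * g x with hj
  have hjc : Continuous j := (Real.continuous_rpow_const hε0.le).mul g.continuous
  have hj0 : j 0 = 0 := by simp [hj, Real.zero_rpow hε0.ne']
  have hmul : ∀ l x : ℝ, 0 ≤ l → l ≤ 1 → 0 < x → ∀ A : ℝ,
      ∫ s in (x * l)..x, s ^ (-γ + μ) * A * j s =
        x ^ (1 - γ + μ + ε) * (A * ∫ t in l..1, t ^ (-γ + μ + ε) * g (x * t)) := by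
    intro l x hl hl1 hx A
    have h1 := aux_subst (-γ + μ + ε) l x hl hl1 hx g
    rw [show -γ + μ + ε + 1 = 1 - γ + μ + ε by ring] at h1
    rw [mul_left_comm, ← h1, ← intervalIntegral.integral_const_mul]
    refine intervalIntegral.integral_congr_ae (ae_of_all _ fun s hs => ?_)
    rw [uIoc_of_le (by nlinarith)] at hs
    have hs0 : 0 < s := lt_of_le_of_lt (by positivity) hs.1
    simp only [hj]
    rw [Real.rpow_add hs0 (-γ + μ) ε]
    ring
  have hfix : ∀ x ∈ Icc 0 z, j x = T j x := by
    intro x hx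
    rcases hx.1.eq_or_lt with rfl | hx0
    · rw [hj0]; simp [T]
    simp only [T]
    have i1 := hmul (1/2) x (by norm_num) (by norm_num) hx0 (2 / (1 - θ))
    have i2 := hmul 0 x (by norm_num) (by norm_num) hx0 1
    have i3 := aux_subst (-γ + 2 * μ) (1/2) x (by norm_num) (by norm_num) hx0
      (fun s => (-c + j s) ^ 2)
    rw [show x * (1/2) = x / 2 by ring] at i1 i3
    simp only [mul_one, mul_zero, one_mul] at i2
    rw [i1, i2, i3]
    simp only [hj]
    rw [hg x hx]
    have p1 : x ^ (-(1 - γ + μ)) * x ^ (1 - γ + μ + ε) = x ^ ε := by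
      rw [← Real.rpow_add hx0]; congr 1; ring
    have p2 : x ^ (-(1 - γ + μ)) * x ^ (-γ + 2 * μ + 1) = x ^ ε * x ^ (μ - ε) := by
      rw [← Real.rpow_add hx0, ← Real.rpow_add hx0]; congr 1; ring
    rw [← hC]
    linear_combination (-(1/β) * ((2 / (1 - θ)) * (∫ t in (1/2:ℝ)..1, t ^ (-γ + μ + ε) * g (x * t)) + C * ∫ t in (0:ℝ)..1, t ^ (-γ + μ + ε) * g (x * t))) * p1
      - (1/β) * (∫ t in (1/2:ℝ)..1, t ^ (-γ + 2 * μ) * (-c + (x * t) ^ ε * g (x * t)) ^ 2) * p2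
  refine ⟨z, hz, j, hjc.continuousOn, hj0, ⟨‖g‖, ?_⟩, hfix, ?_, ?_⟩
  · intro x hx
    have h0 : 0 ≤ x ^ ε := Real.rpow_nonneg hx.1.le _
    simp only [hj]
    rw [abs_mul, abs_of_nonneg h0, mul_comm]
    exact mul_le_mul_of_nonneg_right (g.norm_coe_le_norm x) h0
  · intro x hx
    have hx0 : 0 < x := hx.1
    have hf := hfix x ⟨hx.1.le, hx.2⟩
    simp only [T] at hf
    have hI : ∀ r : ℝ, -1 < r → ∀ G : ℝ → ℝ, Continuous G → ∀ u v : ℝ,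
        IntervalIntegrable (fun s => s ^ r * G s) volume u v := fun r hr G hG u v =>
      (intervalIntegral.intervalIntegrable_rpow' hr).mul_continuousOn hG.continuousOn
    have e1 : ∫ s in (x/2)..x, s ^ (-γ) * (1 / (1 - θ) + s ^ μ * (-c + j s)) ^ 2 =
        (1 / (1 - θ)) ^ 2 * (∫ s in (x/2)..x, s ^ (-γ)) +
        (2 / (1 - θ)) * (-c) * (∫ s in (x/2)..x, s ^ (-γ + μ)) +
        (∫ s in (x/2)..x, s ^ (-γ + μ) * (2 / (1 - θ)) * j s) +
         (∫ s in (x/2)..x, s ^ (-γ + 2*μ) * (-c + j s) ^ 2) := by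
      have a1 : IntervalIntegrable (fun s : ℝ => (1 / (1 - θ)) ^ 2 * s ^ (-γ)) volume (x/2) x :=
        (intervalIntegral.intervalIntegrable_rpow' (by linarith)).const_mul _
      have a2 : IntervalIntegrable (fun s : ℝ => (2 / (1 - θ)) * (-c) * s ^ (-γ + μ)) volume (x/2) x :=
        (intervalIntegral.intervalIntegrable_rpow' (by linarith)).const_mul _
      have a3 : IntervalIntegrable (fun s : ℝ => s ^ (-γ + μ) * (2 / (1 - θ)) * j s) volume (x/2) x := by
        simp only [mul_assoc]
        exact hI _ (by linarith) _ (by fun_prop) _ _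
      have a4 : IntervalIntegrable (fun s : ℝ => s ^ (-γ + 2*μ) * (-c + j s) ^ 2) volume (x/2) x :=
        hI _ (by linarith) _ (by fun_prop) _ _
      rw [← intervalIntegral.integral_const_mul, ← intervalIntegral.integral_const_mul,
        ← intervalIntegral.integral_add a1 a2, ← intervalIntegral.integral_add (a1.add a2) a3,
        ← intervalIntegral.integral_add ((a1.add a2).add a3) a4]
      refine intervalIntegral.integral_congr_ae (ae_of_all _ fun s hs => ?_)
      rw [uIoc_of_le (by linarith)] at hs
      have hs0 : 0 < s := lt_of_le_of_lt (by positivity) hs.1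
      rw [Real.rpow_add hs0, Real.rpow_add hs0, two_mul μ, Real.rpow_add hs0]
      ring
    have e2 : ∫ s in (0:ℝ)..x, s ^ (-γ) * (1 / (1 - θ) + s ^ μ * (-c + j s)) =
        (1 / (1 - θ)) * (∫ s in (0:ℝ)..x, s ^ (-γ)) +
        (-c) * (∫ s in (0:ℝ)..x, s ^ (-γ + μ)) +
        (∫ s in (0:ℝ)..x, s ^ (-γ + μ) * j s) := by
      have a1 : IntervalIntegrable (fun s : ℝ => (1 / (1 - θ)) * s ^ (-γ)) volume 0 x :=
        (intervalIntegral.intervalIntegrable_rpow' (by linarith)).const_mul _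
      have a2 : IntervalIntegrable (fun s : ℝ => (-c) * s ^ (-γ + μ)) volume 0 x :=
        (intervalIntegral.intervalIntegrable_rpow' (by linarith)).const_mul _
      have a3 : IntervalIntegrable (fun s : ℝ => s ^ (-γ + μ) * j s) volume 0 x :=
        hI _ (by linarith) _ hjc _ _
      rw [← intervalIntegral.integral_const_mul, ← intervalIntegral.integral_const_mul,
        ← intervalIntegral.integral_add a1 a2, ← intervalIntegral.integral_add (a1.add a2) a3]
      refine intervalIntegral.integral_congr_ae (ae_of_all _ fun s hs => ?_)
      rw [uIoc_of_le hx0.le] at hs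
      have hs0 : 0 < s := hs.1
      rw [Real.rpow_add hs0]
      ring
    simp only
    rw [e1, e2]
    set J1 := ∫ s in (x/2)..x, s ^ (-γ + μ) * (2 / (1 - θ)) * j s
    set J2 := ∫ s in (x/2)..x, s ^ (-γ + 2*μ) * (-c + j s) ^ 2
    set J3 := ∫ s in (0:ℝ)..x, s ^ (-γ + μ) * j s
    have q1 : x ^ (1 - γ) * x ^ μ * x ^ (-(1 - γ + μ)) = 1 := by
      rw [← Real.rpow_add hx0, ← Real.rpow_add hx0]
      rw [show 1 - γ + μ + -(1 - γ + μ) = 0 by ring, Real.rpow_zero]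
    have hfj : β * x ^ (1 - γ) * x ^ μ * j x = J1 + J2 + C * J3 := by
      rw [hf]
      have : β * (1 / β) = 1 := by field_simp
      linear_combination (J1 + J2 + C * J3) * q1 + (J1 + J2 + C * J3) * (x ^ (1 - γ) * x ^ μ * x ^ (-(1 - γ + μ))) * this
    have hhalf : ∀ r : ℝ, (x / 2) ^ r = x ^ r * (2:ℝ) ^ (-r) := by
      intro r
      rw [Real.div_rpow hx0.le two_pos.le, Real.rpow_neg two_pos.le, div_eq_mul_inv]
    have m1 : ∫ s in (x/2)..x, s ^ (-γ) = x ^ (1 - γ) * (1 - θ) / (1 - γ) := by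
      rw [integral_rpow (Or.inl (by linarith)), show -γ + 1 = 1 - γ by ring, hhalf,
        show -(1 - γ) = γ - 1 by ring]
      ring
    have m2 : ∫ s in (x/2)..x, s ^ (-γ + μ) =
        x ^ (1 - γ) * x ^ μ * (1 - (2:ℝ) ^ (γ - 1 - μ)) / (1 - γ + μ) := by
      rw [integral_rpow (Or.inl (by linarith)), show -γ + μ + 1 = 1 - γ + μ by ring, hhalf,
        show -(1 - γ + μ) = γ - 1 - μ by ring, Real.rpow_add hx0]
      ring
    have m3 : ∫ s in (0:ℝ)..x, s ^ (-γ) = x ^ (1 - γ) / (1 - γ) := by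
      rw [integral_rpow (Or.inl (by linarith)), show -γ + 1 = 1 - γ by ring,
        Real.zero_rpow h1γ.ne', sub_zero]
    have m4 : ∫ s in (0:ℝ)..x, s ^ (-γ + μ) = x ^ (1 - γ) * x ^ μ / (1 - γ + μ) := by
      rw [integral_rpow (Or.inl (by linarith)), show -γ + μ + 1 = 1 - γ + μ by ring,
        Real.zero_rpow (by linarith), sub_zero, Real.rpow_add hx0]
    rw [m1, m2, m3, m4]
    set P := x ^ (1 - γ)
    set Q := x ^ μ
    set y := (2:ℝ) ^ (γ - 1 - μ)
    have hsum : 0 < 1 - γ + μ := by linarith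
    have z1 : β * P * (1 / (1 - θ)) = (1 / (1 - θ)) ^ 2 * (P * (1 - θ) / (1 - γ)) +
        C * ((1 / (1 - θ)) * (P / (1 - γ))) := by
      rw [hC]; field_simp; ring
    have hμ' : 1 + β * μ = 2 / (1 - θ) * (1 - y) := by
      have : (1 - y) / (1 - θ) = (1 + β * μ) / 2 := hμ.symm
      rw [div_mul_eq_mul_div, mul_div_assoc, this]; ring
    have hC' : C = (1 - γ) * β - 1 := by rw [hC]; field_simp
    have z2 : β * P * Q = 2 / (1 - θ) * (P * Q * (1 - y) / (1 - γ + μ)) +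
        C * (P * Q / (1 - γ + μ)) := by
      have : 2 / (1 - θ) * (P * Q * (1 - y) / (1 - γ + μ)) =
          (2 / (1 - θ) * (1 - y)) * (P * Q) / (1 - γ + μ) := by ring
      rw [this, ← hμ', hC']
      field_simp
      ring
    linear_combination z1 - c * z2 + hfj
  · have hjt : Tendsto j (𝓝[>] 0) (𝓝 0) := by
      have := hjc.tendsto 0
      rw [hj0] at this
      exact this.mono_left nhdsWithin_le_nhds
    have h1 : (fun x => j x) =o[𝓝[>] 0] (fun _ => (1:ℝ)) :=
      (Asymptotics.isLittleO_one_iff ℝ).2 hjt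
    have h2 := (Asymptotics.isBigO_refl (fun x : ℝ => x ^ μ) (𝓝[>] 0)).mul_isLittleO h1
    refine h2.congr (fun x => ?_) (fun x => ?_)
    · ring
    · ring
end

section
/- Let γ < 1, β ≥ β_* := 1/(1−γ), θ := 2^{γ−1}, μ > 0 the unique positive solution of (1 + βμ)/2 = (1 − 2^{γ−1−μ})/(1 − θ), c ∈ ℝ, ε ∈ (0,μ), and let j : [0,z] → ℝ be a fixed point of the operator T[j](x) := (1/β) x^{−(1−γ+μ)} ( ∫_{x/2}^x s^{−γ+μ} (2/(1−θ)) j(s) ds + ∫_{x/2}^x s^{−γ+2μ} (−c + j(s))² ds + (1−γ)(β − β_*) ∫_0^x s^{−γ+μ} j(s) ds ) with j(0) = 0 and sup_{x∈(0,z]} x^{−ε}|j(x)| < ∞. Then j is differentiable on (0,z) and there is a constant C > 0 such that |j'(x)| ≤ C |j(x)|/x + C x^{μ−1} for all x ∈ (0,z). -/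
open Filter Topology MeasureTheory Set

lemma aux_ii_s9 (e z : ℝ) (he : -1 < e) (g : ℝ → ℝ) (hg : ContinuousOn g (Icc 0 z))
    (u x : ℝ) (hu : u ∈ Icc 0 z) (hx : x ∈ Icc 0 z) :
    IntervalIntegrable (fun s => s ^ e * g s) volume u x := by
  apply IntervalIntegrable.mul_continuousOn
  · exact intervalIntegral.intervalIntegrable_rpow' he
  · apply hg.mono
    intro s hs
    rw [mem_uIcc] at hs
    simp only [mem_Icc] at *
    rcases hs with h | h <;> constructor <;> linarith [h.1, h.2]

lemma aux_deriv0 (e z : ℝ) (he : -1 < e) (g : ℝ → ℝ) (hg : ContinuousOn g (Icc 0 z))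
    (x : ℝ) (hx : x ∈ Ioo 0 z) :
    HasDerivAt (fun y => ∫ s in (0:ℝ)..y, s ^ e * g s) (x ^ e * g x) x := by
  have hc : ContinuousOn (fun s => s ^ e * g s) (Ioo 0 z) := by
    apply ContinuousOn.mul
    · intro s hs
      exact (Real.continuousAt_rpow_const s e (Or.inl hs.1.ne')).continuousWithinAt
    · exact hg.mono Ioo_subset_Icc_self
  apply intervalIntegral.integral_hasDerivAt_right
  · exact aux_ii_s9 e z he g hg 0 x ⟨le_rfl, (hx.1.trans hx.2).le⟩ ⟨hx.1.le, hx.2.le⟩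
  · exact hc.stronglyMeasurableAtFilter isOpen_Ioo x hx
  · exact hc.continuousAt (isOpen_Ioo.mem_nhds hx)

lemma aux_deriv1 (e z : ℝ) (he : -1 < e) (g : ℝ → ℝ) (hg : ContinuousOn g (Icc 0 z))
    (x : ℝ) (hx : x ∈ Ioo 0 z) :
    HasDerivAt (fun y => ∫ s in (y/2)..y, s ^ e * g s)
      (x ^ e * g x - (x/2) ^ e * g (x/2) * (1/2)) x := by
  have h1 := aux_deriv0 e z he g hg x hx
  have h2 := aux_deriv0 e z he g hg (x/2) ⟨by linarith [hx.1], by linarith [hx.1, hx.2]⟩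
  have h3 : HasDerivAt (fun y : ℝ => y / 2) (1/2) x := (hasDerivAt_id x).div_const 2
  have h4 := HasDerivAt.comp x h2 h3
  have h5 := h1.sub h4
  apply h5.congr_of_eventuallyEq
  filter_upwards [isOpen_Ioo.mem_nhds hx] with y hy
  have hz : (0:ℝ) ∈ Icc 0 z := ⟨le_rfl, (hx.1.trans hx.2).le⟩
  have i1 := aux_ii_s9 e z he g hg 0 y hz ⟨hy.1.le, hy.2.le⟩
  have i2 := aux_ii_s9 e z he g hg 0 (y/2) hz ⟨by linarith [hy.1], by linarith [hy.1, hy.2]⟩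
  simp only [Pi.sub_apply, Function.comp]
  rw [intervalIntegral.integral_interval_sub_left i1 i2]

lemma aux_bound_s9 (e z a b α1 α2 : ℝ) (he : -1 < e) (h1 : 0 ≤ α1) (h2 : 0 ≤ α2) (g : ℝ → ℝ)
    (hg : ∀ s ∈ Ioc 0 z, |g s| ≤ a * s ^ α1 + b * s ^ α2)
    (u x : ℝ) (hu : 0 ≤ u) (hux : u ≤ x) (hx : x ≤ z) :
    |∫ s in u..x, s ^ e * g s| ≤ a * ((x ^ (e + 1 + α1) - u ^ (e + 1 + α1)) / (e + 1 + α1))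
      + b * ((x ^ (e + 1 + α2) - u ^ (e + 1 + α2)) / (e + 1 + α2)) := by
  have j1 : IntervalIntegrable (fun s : ℝ => a * s ^ (e + α1)) volume u x :=
    (intervalIntegral.intervalIntegrable_rpow' (by linarith)).const_mul a
  have j2 : IntervalIntegrable (fun s : ℝ => b * s ^ (e + α2)) volume u x :=
    (intervalIntegral.intervalIntegrable_rpow' (by linarith)).const_mul b
  have key := intervalIntegral.norm_integral_le_of_norm_le (μ := volume)
    (f := fun s => s ^ e * g s) (g := fun s => a * s ^ (e + α1) + b * s ^ (e + α2)) hux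
    (ae_of_all _ (fun s hs => by
      have hs0 : 0 < s := lt_of_le_of_lt hu hs.1
      have hb := hg s ⟨hs0, hs.2.trans hx⟩
      rw [Real.norm_eq_abs, abs_mul, abs_of_pos (Real.rpow_pos_of_pos hs0 e),
        Real.rpow_add hs0, Real.rpow_add hs0]
      nlinarith [mul_le_mul_of_nonneg_left hb (Real.rpow_pos_of_pos hs0 e).le])) (j1.add j2)
  rw [intervalIntegral.integral_add j1 j2, intervalIntegral.integral_const_mul,
    intervalIntegral.integral_const_mul, integral_rpow (Or.inl (by linarith)),
    integral_rpow (Or.inl (by linarith))] at key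
  rw [Real.norm_eq_abs, show e + α1 + 1 = e + 1 + α1 by ring,
    show e + α2 + 1 = e + 1 + α2 by ring] at key
  exact key

lemma aux_half (x r : ℝ) (hx : 0 < x) : (x / 2) ^ r = x ^ r * 2 ^ (-r) := by
  rw [Real.div_rpow hx.le (by norm_num), Real.rpow_neg (by norm_num)]; rfl

lemma aux_conv_s9 (q a : ℝ) (hq : 0 < q) (ha : 0 < a) :
    q * (1 - (2:ℝ) ^ (-(q + a))) < (q + a) * (1 - (2:ℝ) ^ (-q)) := by
  have hl : 0 < Real.log 2 := Real.log_pos (by norm_num)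
  have h := strictConvexOn_exp.2 (mem_univ (Real.log 2 * (-(q + a)))) (mem_univ (0:ℝ))
    (mul_ne_zero hl.ne' (by linarith) : Real.log 2 * (-(q + a)) ≠ 0)
    (by positivity : 0 < q / (q + a)) (by positivity : 0 < a / (q + a)) (by field_simp)
  rw [Real.rpow_def_of_pos (by norm_num), Real.rpow_def_of_pos (by norm_num)]
  have e1 : (q / (q + a)) • (Real.log 2 * (-(q + a))) + (a / (q + a)) • (0:ℝ)
      = Real.log 2 * (-q) := by
    simp only [smul_eq_mul]; field_simp; ring
  rw [e1] at h
  simp only [smul_eq_mul, Real.exp_zero] at h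
  have h' := mul_lt_mul_of_pos_left h (by positivity : 0 < q + a)
  have e2 : (q + a) * (q / (q + a) * Real.exp (Real.log 2 * (-(q + a))) + a / (q + a) * 1)
    = q * Real.exp (Real.log 2 * (-(q + a))) + a := by field_simp
  rw [e2] at h'
  linarith

lemma aux_lam (q a K D β : ℝ) (hq : 0 < q) (ha : 0 < a) (hβ : 0 < β) (hK : 0 < K) (hD : 0 ≤ D)
    (h : K * (1 - (2:ℝ) ^ (-q)) + D = β * q) :
    (1 / β) * ((K * (1 - (2:ℝ) ^ (-(q + a))) + D) / (q + a)) < 1 := by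
  have hc := aux_conv_s9 q a hq ha
  rw [one_div_mul_eq_div, div_div, div_lt_one (by positivity)]
  have := mul_lt_mul_of_pos_left hc hK
  have h2 : (K * (1 - (2:ℝ) ^ (-(q + a))) + D) * q < ((q + a) * β) * q := by
    nlinarith [mul_nonneg hD ha.le]
  exact lt_of_mul_lt_mul_right h2 hq.le

set_option maxHeartbeats 1000000 in
theorem stmt9 (γ β μ c ε z : ℝ) (hγ : γ < 1) (hβ : 1 / (1 - γ) ≤ β)
    (hμpos : 0 < μ)
    (hμ : (1 + β * μ) / 2 = (1 - (2:ℝ) ^ (γ - 1 - μ)) / (1 - (2:ℝ) ^ (γ - 1)))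
    (hε : ε ∈ Set.Ioo 0 μ) (hz : 0 < z) (j : ℝ → ℝ)
    (hcont : ContinuousOn j (Set.Icc 0 z)) (hj0 : j 0 = 0)
    (hbound : ∃ M : ℝ, ∀ x ∈ Set.Ioc 0 z, |j x| ≤ M * x ^ ε)
    (hfix : ∀ x ∈ Set.Icc 0 z, j x =
      (1/β) * x ^ (-(1 - γ + μ)) *
        ((∫ s in (x/2)..x, s ^ (-γ + μ) * (2 / (1 - (2:ℝ) ^ (γ - 1))) * j s) +
         (∫ s in (x/2)..x, s ^ (-γ + 2*μ) * (-c + j s) ^ 2) +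
         (1 - γ) * (β - 1 / (1 - γ)) * ∫ s in (0:ℝ)..x, s ^ (-γ + μ) * j s)) :
    (∀ x ∈ Set.Ioo 0 z, DifferentiableAt ℝ j x) ∧
    ∃ C > 0, ∀ x ∈ Set.Ioo 0 z, |deriv j x| ≤ C * |j x| / x + C * x ^ (μ - 1) := by
  have hg1 : 0 < 1 - γ := by linarith
  have hβ0 : 0 < β := lt_of_lt_of_le (by positivity) hβ
  have hθ : (2:ℝ) ^ (γ - 1) < 1 := Real.rpow_lt_one_of_one_lt_of_neg (by norm_num) (by linarith)
  have hK1 : 0 < 1 - (2:ℝ) ^ (γ - 1) := by linarith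
  obtain ⟨K, hKdef⟩ : ∃ K, K = 2 / (1 - (2:ℝ) ^ (γ - 1)) := ⟨_, rfl⟩
  obtain ⟨D, hDdef⟩ : ∃ D, D = (1 - γ) * (β - 1 / (1 - γ)) := ⟨_, rfl⟩
  obtain ⟨q, hqdef⟩ : ∃ q, q = 1 - γ + μ := ⟨_, rfl⟩
  have hK : 0 < K := by rw [hKdef]; positivity
  have hD : 0 ≤ D := by rw [hDdef]; exact mul_nonneg hg1.le (by linarith)
  have hD' : D = (1 - γ) * β - 1 := by rw [hDdef]; field_simp
  have hq : 0 < q := by rw [hqdef]; linarith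
  have hid : K * (1 - (2:ℝ) ^ (-q)) + D = β * q := by
    have : -q = γ - 1 - μ := by rw [hqdef]; ring
    rw [this, hD', hKdef, hqdef, div_mul_eq_mul_div, mul_div_assoc, ← hμ]
    ring
  have hfix' : ∀ x ∈ Set.Icc 0 z, j x = (1/β) * x ^ (-q) *
        (K * (∫ s in (x/2)..x, s ^ (q - 1) * j s) +
         (∫ s in (x/2)..x, s ^ (q - 1 + μ) * (-c + j s) ^ 2) +
         D * ∫ s in (0:ℝ)..x, s ^ (q - 1) * j s) := by
    intro x hx
    have h := hfix x hx
    rw [← hKdef, ← hDdef, ← hqdef, show -γ + μ = q - 1 by rw [hqdef]; ring,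
      show -γ + 2 * μ = q - 1 + μ by rw [hqdef]; ring] at h
    rw [← intervalIntegral.integral_const_mul]
    rw [h]
    congr 4
    ext s; ring
  clear hfix
  have hcont2 : ContinuousOn (fun s => (-c + j s) ^ 2) (Icc 0 z) :=
    (continuousOn_const.add hcont).pow 2
  obtain ⟨N, hN⟩ : ∃ N, ∀ s ∈ Icc 0 z, ‖(-c + j s) ^ 2‖ ≤ N :=
    isCompact_Icc.exists_bound_of_continuousOn hcont2
  have hN0 : 0 ≤ N := (norm_nonneg _).trans (hN 0 ⟨le_rfl, hz.le⟩)
  obtain ⟨lam, hlam⟩ : ∃ lam : ℝ → ℝ, ∀ a, lam a =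
    (1 / β) * ((K * (1 - (2:ℝ) ^ (-(q + a))) + D) / (q + a)) := ⟨_, fun _ => rfl⟩
  have hlam1 : ∀ a, 0 < a → lam a < 1 := fun a ha => by
    rw [hlam]; exact aux_lam q a K D β hq ha hβ0 hK hD hid
  have h2le : ∀ a : ℝ, 0 < a → (2:ℝ) ^ (-a) < 1 := fun a ha =>
    Real.rpow_lt_one_of_one_lt_of_neg (by norm_num) (by linarith)
  have hlam0 : ∀ a, 0 < a → 0 ≤ lam a := fun a ha => by
    have : 0 < 1 - (2:ℝ) ^ (-(q + a)) := by linarith [h2le (q + a) (by linarith)]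
    rw [hlam]; positivity
  obtain ⟨A, hA⟩ : ∃ A, A = (1 / β) * (N * ((1 - (2:ℝ) ^ (-(q + μ))) / (q + μ))) := ⟨_, rfl⟩
  have hA0 : 0 ≤ A := by
    have : 0 < 1 - (2:ℝ) ^ (-(q + μ)) := by linarith [h2le (q + μ) (by linarith)]
    rw [hA]; positivity
  have step : ∀ a B : ℝ, (∀ x ∈ Ioc 0 z, |j x| ≤ a * x ^ ε + B * x ^ μ) →
      ∀ x ∈ Ioc 0 z, |j x| ≤ (lam ε * a) * x ^ ε + (lam μ * B + A) * x ^ μ := by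
    intro a B h x hx
    have hx0 := hx.1
    have b1 := aux_bound_s9 (q - 1) z a B ε μ (by linarith) hε.1.le hμpos.le j h (x/2) x
      (by linarith) (by linarith) hx.2
    have b3 := aux_bound_s9 (q - 1) z a B ε μ (by linarith) hε.1.le hμpos.le j h 0 x
      le_rfl hx0.le hx.2
    have b2 := aux_bound_s9 (q - 1 + μ) z N 0 0 0 (by linarith) le_rfl le_rfl
      (fun s => (-c + j s) ^ 2) (fun s hs => by
        have := hN s ⟨hs.1.le, hs.2⟩
        simpa using this) (x/2) x
      (by linarith) (by linarith) hx.2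
    have hε0 := hε.1
    rw [show q - 1 + 1 = q by ring, aux_half x _ hx0, aux_half x _ hx0] at b1
    rw [show q - 1 + 1 = q by ring, Real.zero_rpow (by linarith), Real.zero_rpow (by linarith)] at b3
    rw [show q - 1 + μ + 1 + 0 = q + μ by ring, aux_half x _ hx0] at b2
    have hxq : 0 < x ^ (-q) := Real.rpow_pos_of_pos hx0 _
    have eq1 : x ^ (-q) * x ^ q = 1 := by rw [← Real.rpow_add hx0]; simp
    rw [hfix' x ⟨hx0.le, hx.2⟩, abs_mul, abs_of_pos (by positivity : 0 < 1 / β * x ^ (-q))]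
    rw [Real.rpow_add hx0, Real.rpow_add hx0] at b1 b3
    rw [Real.rpow_add hx0] at b2
    calc _ ≤ 1 / β * x ^ (-q) * (K *
            (a * ((x ^ q * x ^ ε - x ^ q * x ^ ε * 2 ^ (-(q + ε))) / (q + ε)) +
              B * ((x ^ q * x ^ μ - x ^ q * x ^ μ * 2 ^ (-(q + μ))) / (q + μ))) +
            (N * ((x ^ q * x ^ μ - x ^ q * x ^ μ * 2 ^ (-(q + μ))) / (q + μ)) +
              0 * ((x ^ q * x ^ μ - x ^ q * x ^ μ * 2 ^ (-(q + μ))) / (q + μ))) +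
            D * (a * ((x ^ q * x ^ ε - 0) / (q + ε)) + B * ((x ^ q * x ^ μ - 0) / (q + μ)))) := by
          apply mul_le_mul_of_nonneg_left _ (by positivity)
          refine (abs_add_le _ _).trans (add_le_add ((abs_add_le _ _).trans (add_le_add ?_ b2)) ?_)
          · rw [abs_mul, abs_of_pos hK]; exact mul_le_mul_of_nonneg_left b1 hK.le
          · rw [abs_mul, abs_of_nonneg hD]; exact mul_le_mul_of_nonneg_left b3 hD
      _ = (x ^ (-q) * x ^ q) * ((lam ε * a) * x ^ ε + (lam μ * B + A) * x ^ μ) := by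
          rw [hlam, hlam, hA]; ring
      _ = _ := by rw [eq1, one_mul]
  obtain ⟨M, hM⟩ := hbound
  obtain ⟨B, hB⟩ : ∃ B, B = A / (1 - lam μ) := ⟨_, rfl⟩
  have hlm : 0 < 1 - lam μ := by linarith [hlam1 μ hμpos]
  have hB0 : 0 ≤ B := by rw [hB]; positivity
  have hBf : lam μ * B + A = B := by rw [hB]; field_simp; ring
  have iter : ∀ n : ℕ, ∀ x ∈ Ioc 0 z, |j x| ≤ (lam ε ^ n * M) * x ^ ε + B * x ^ μ := by
    intro n
    induction n with
    | zero =>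
      intro x hx
      have := hM x hx
      have : 0 ≤ B * x ^ μ := mul_nonneg hB0 (Real.rpow_nonneg hx.1.le _)
      simp; linarith
    | succ n ih =>
      intro x hx
      have := step _ _ ih x hx
      rw [hBf] at this
      rw [pow_succ]
      convert this using 3; ring
  have jB : ∀ x ∈ Ioc 0 z, |j x| ≤ B * x ^ μ := by
    intro x hx
    have t := tendsto_pow_atTop_nhds_zero_of_lt_one (hlam0 ε hε.1) (hlam1 ε hε.1)
    have t2 : Tendsto (fun n : ℕ => (lam ε ^ n * M) * x ^ ε + B * x ^ μ) atTop
        (𝓝 ((0 * M) * x ^ ε + B * x ^ μ)) :=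
      ((t.mul_const M).mul_const _).add_const _
    have := ge_of_tendsto' t2 (fun n => iter n x hx)
    simpa using this
  have hder : ∀ x ∈ Ioo 0 z, HasDerivAt j ((1/β) * (-q * x ^ (-q - 1)) *
        (K * (∫ s in (x/2)..x, s ^ (q - 1) * j s) +
         (∫ s in (x/2)..x, s ^ (q - 1 + μ) * (-c + j s) ^ 2) +
         D * ∫ s in (0:ℝ)..x, s ^ (q - 1) * j s) + (1/β) * x ^ (-q) *
        (K * (x ^ (q - 1) * j x - (x/2) ^ (q - 1) * j (x/2) * (1/2)) +
         (x ^ (q - 1 + μ) * (-c + j x) ^ 2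
          - (x/2) ^ (q - 1 + μ) * (-c + j (x/2)) ^ 2 * (1/2)) +
         D * (x ^ (q - 1) * j x))) x := by
    intro x hx
    have d1 := aux_deriv1 (q - 1) z (by linarith) j hcont x hx
    have d2 := aux_deriv1 (q - 1 + μ) z (by linarith) _ hcont2 x hx
    have d3 := aux_deriv0 (q - 1) z (by linarith) j hcont x hx
    have d0 := (Real.hasDerivAt_rpow_const (p := -q) (Or.inl hx.1.ne')).const_mul (1/β)
    have d := d0.mul (((d1.const_mul K).add d2).add (d3.const_mul D))
    apply d.congr_of_eventuallyEq
    filter_upwards [isOpen_Ioo.mem_nhds hx] with y hy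
    exact hfix' y ⟨hy.1.le, hy.2.le⟩
  refine ⟨fun x hx => (hder x hx).differentiableAt, ?_⟩
  obtain ⟨P, hP⟩ : ∃ P, P = (2:ℝ) ^ (-(q - 1)) := ⟨_, rfl⟩
  obtain ⟨R, hR⟩ : ∃ R, R = (2:ℝ) ^ (-(q - 1 + μ)) := ⟨_, rfl⟩
  have hP0 : 0 < P := by rw [hP]; positivity
  have hR0 : 0 < R := by rw [hR]; positivity
  refine ⟨q * B + (1/β) * (K * (B + P * B) + (N + R * N) + D * B) + 1, by positivity, ?_⟩
  intro x hx
  have hx0 := hx.1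
  have hS := hfix' x ⟨hx0.le, hx.2.le⟩
  rw [(hder x hx).deriv]
  generalize (K * (∫ s in (x/2)..x, s ^ (q - 1) * j s) +
         (∫ s in (x/2)..x, s ^ (q - 1 + μ) * (-c + j s) ^ 2) +
         D * ∫ s in (0:ℝ)..x, s ^ (q - 1) * j s) = S at hS ⊢
  have hb1 : |j x| ≤ B * x ^ μ := jB x ⟨hx0, hx.2.le⟩
  have hb2 : |j (x/2)| ≤ B * x ^ μ := by
    refine (jB (x/2) ⟨by linarith, by linarith [hx.2]⟩).trans
      (mul_le_mul_of_nonneg_left ?_ hB0)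
    exact Real.rpow_le_rpow (by linarith) (by linarith) hμpos.le
  have hn1 : |(-c + j x) ^ 2| ≤ N := hN x ⟨hx0.le, hx.2.le⟩
  have hn2 : |(-c + j (x/2)) ^ 2| ≤ N := hN (x/2) ⟨by linarith, by linarith [hx.2]⟩
  have eq1 : x ^ (-q) * x ^ q = 1 := by rw [← Real.rpow_add hx0]; simp
  have e0 : x ^ (-q - 1) = x ^ (-q) * x⁻¹ := by
    rw [Real.rpow_sub_one hx0.ne']; rfl
  have e1 : x ^ (q - 1) = x ^ q * x⁻¹ := by rw [Real.rpow_sub_one hx0.ne']; rfl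
  have e2 : x ^ (q - 1 + μ) = x ^ q * x⁻¹ * x ^ μ := by rw [Real.rpow_add hx0, e1]
  have e3 : x ^ (μ - 1) = x ^ μ * x⁻¹ := by rw [Real.rpow_sub_one hx0.ne']; rfl
  rw [aux_half x _ hx0, aux_half x _ hx0, ← hP, ← hR, e0, e1, e2, e3]
  have hX : 0 < x ^ μ := Real.rpow_pos_of_pos hx0 _
  generalize x ^ μ = X at *
  have form : 1 / β * (-q * (x ^ (-q) * x⁻¹)) * S + 1 / β * x ^ (-q) *
        (K * (x ^ q * x⁻¹ * j x - x ^ q * x⁻¹ * P * j (x/2) * (1/2)) +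
         (x ^ q * x⁻¹ * X * (-c + j x) ^ 2
          - x ^ q * x⁻¹ * X * R * (-c + j (x/2)) ^ 2 * (1/2)) +
         D * (x ^ q * x⁻¹ * j x)) =
      x⁻¹ * (-q * j x + (1/β) * (K * (j x - P * j (x/2) * (1/2)) +
        (X * (-c + j x) ^ 2 - X * R * (-c + j (x/2)) ^ 2 * (1/2)) + D * j x)) := by
    have : 1 / β * (-q * (x ^ (-q) * x⁻¹)) * S = x⁻¹ * (-q * j x) := by rw [hS]; ring
    rw [this]
    linear_combination (1/β) * x⁻¹ * (K * (j x - P * j (x/2) * (1/2)) +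
        (X * (-c + j x) ^ 2 - X * R * (-c + j (x/2)) ^ 2 * (1/2)) + D * j x) * eq1
  rw [form, abs_mul, abs_of_pos (inv_pos.2 hx0)]
  have k1 : |j x - P * j (x/2) * (1/2)| ≤ (B + P * B) * X := by
    refine (abs_sub _ _).trans ?_
    rw [abs_mul, abs_mul, abs_of_pos hP0, abs_of_pos (by norm_num : (0:ℝ) < 1/2)]
    linarith [mul_le_mul_of_nonneg_left hb2 hP0.le, mul_nonneg hP0.le (abs_nonneg (j (x/2)))]
  have k2 : |X * (-c + j x) ^ 2 - X * R * (-c + j (x/2)) ^ 2 * (1/2)| ≤ (N + R * N) * X := by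
    refine (abs_sub _ _).trans ?_
    rw [abs_mul, abs_mul, abs_mul, abs_of_pos hX, abs_of_pos (by positivity : 0 < X * R),
      abs_of_pos (by norm_num : (0:ℝ) < 1/2)]
    linarith [mul_le_mul_of_nonneg_left hn1 hX.le,
      mul_le_mul_of_nonneg_left hn2 (by positivity : 0 ≤ X * R),
      mul_nonneg (by positivity : 0 ≤ X * R) (abs_nonneg ((-c + j (x/2)) ^ 2))]
  have k3 : |-q * j x + (1/β) * (K * (j x - P * j (x/2) * (1/2)) +
        (X * (-c + j x) ^ 2 - X * R * (-c + j (x/2)) ^ 2 * (1/2)) + D * j x)| ≤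
      q * (B * X) + (1/β) * (K * ((B + P * B) * X) + (N + R * N) * X + D * (B * X)) := by
    refine (abs_add_le _ _).trans (add_le_add ?_ ?_)
    · rw [abs_mul, abs_neg, abs_of_pos hq]; exact mul_le_mul_of_nonneg_left hb1 hq.le
    · rw [abs_mul, abs_of_pos (by positivity : 0 < 1/β)]
      apply mul_le_mul_of_nonneg_left _ (by positivity)
      refine (abs_add_le _ _).trans (add_le_add ((abs_add_le _ _).trans (add_le_add ?_ k2)) ?_)
      · rw [abs_mul, abs_of_pos hK]; exact mul_le_mul_of_nonneg_left k1 hK.le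
      · rw [abs_mul, abs_of_nonneg hD]; exact mul_le_mul_of_nonneg_left hb1 hD
  have k4 := mul_le_mul_of_nonneg_left k3 (inv_pos.2 hx0).le
  have k5 : 0 ≤ (q * B + (1/β) * (K * (B + P * B) + (N + R * N) + D * B) + 1) * |j x| / x := by
    positivity
  have k6 : 0 < X * x⁻¹ := by positivity
  refine k4.trans ?_
  linarith [k5, k6]
end

section
/- Let γ < 1, β ≥ β_* := 1/(1−γ), θ := 2^{γ−1}, μ > 0 the unique positive solution of (1 + βμ)/2 = (1 − 2^{γ−1−μ})/(1 − θ), and c > 0. Let j : [0,z] → ℝ be a fixed point of the operator T (as in the local existence construction) with j(0) = 0 and sup_{x∈(0,z]} x^{−ε}|j(x)| < ∞ for some ε ∈ (0,μ), and set h(x) := 1/(1−θ) + x^{μ}(−c + j(x)). Then there exists z' ∈ (0,z] such that h'(x) < 0 for all x ∈ (0,z'); in particular h is strictly decreasing on (0,z'). -/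
open Filter Topology MeasureTheory Set

lemma aux_int (q z : ℝ) (hq : -1 < q) (k : ℝ → ℝ) (hk : ContinuousOn k (Set.Icc 0 z))
    (x : ℝ) (hx : x ∈ Set.Icc 0 z) :
    IntervalIntegrable (fun s => s ^ q * k s) volume 0 x := by
  apply IntervalIntegrable.mul_continuousOn (intervalIntegral.intervalIntegrable_rpow' hq)
  rw [Set.uIcc_of_le hx.1]
  exact hk.mono (Set.Icc_subset_Icc_right hx.2)

lemma aux_deriv (q z : ℝ) (hq : -1 < q) (k : ℝ → ℝ) (hk : ContinuousOn k (Set.Icc 0 z))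
    (x : ℝ) (hx : x ∈ Set.Ioo 0 z) :
    HasDerivAt (fun y => ∫ s in (0:ℝ)..y, s ^ q * k s) (x ^ q * k x) x := by
  have hc : ContinuousOn (fun s => s ^ q * k s) (Set.Ioo 0 z) := by
    apply ContinuousOn.mul
    · exact fun s hs => (Real.continuousAt_rpow_const s q (Or.inl hs.1.ne')).continuousWithinAt
    · exact hk.mono Set.Ioo_subset_Icc_self
  apply intervalIntegral.integral_hasDerivAt_right
  · exact aux_int q z hq k hk x ⟨hx.1.le, hx.2.le⟩
  · exact hc.stronglyMeasurableAtFilter isOpen_Ioo x hx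
  · exact hc.continuousAt (isOpen_Ioo.mem_nhds hx)

lemma aux_half_s10 (q z : ℝ) (hq : -1 < q) (k : ℝ → ℝ) (hk : ContinuousOn k (Set.Icc 0 z))
    (x : ℝ) (hx : x ∈ Set.Ioo 0 z) :
    HasDerivAt (fun y => ∫ s in (y/2)..y, s ^ q * k s)
      (x ^ q * k x - (x/2) ^ q * k (x/2) * (1/2)) x := by
  have hx2 : x / 2 ∈ Set.Ioo 0 z := ⟨by linarith [hx.1], by linarith [hx.1, hx.2]⟩
  have h1 := aux_deriv q z hq k hk x hx
  have h2 := (aux_deriv q z hq k hk (x/2) hx2).comp x ((hasDerivAt_id x).div_const 2)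
  refine (h1.sub h2).congr_of_eventuallyEq ?_
  filter_upwards [isOpen_Ioo.mem_nhds hx] with y hy
  have := intervalIntegral.integral_interval_sub_left (aux_int q z hq k hk y ⟨hy.1.le, hy.2.le⟩)
    (aux_int q z hq k hk (y/2) ⟨by linarith [hy.1], by linarith [hy.1, hy.2]⟩)
  simp [← this]

/-- For `c > 0`, the local solution `h(x) = 1/(1-θ) + x^μ(-c + j(x))` built from a fixed
point `j` of `T` is strictly decreasing near `0`: there is `z' ∈ (0,z]` with `h' < 0`
on `(0,z')`. -/
theorem stmt10 (γ β μ c ε z : ℝ) (hγ : γ < 1) (hβ : 1 / (1 - γ) ≤ β)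
    (hμpos : 0 < μ)
    (hμ : (1 + β * μ) / 2 = (1 - (2:ℝ) ^ (γ - 1 - μ)) / (1 - (2:ℝ) ^ (γ - 1)))
    (hc : 0 < c) (hε : ε ∈ Set.Ioo 0 μ) (hz : 0 < z) (j : ℝ → ℝ)
    (hcont : ContinuousOn j (Set.Icc 0 z)) (hj0 : j 0 = 0)
    (hbound : ∃ M : ℝ, ∀ x ∈ Set.Ioc 0 z, |j x| ≤ M * x ^ ε)
    (hfix : ∀ x ∈ Set.Icc 0 z, j x =
      (1/β) * x ^ (-(1 - γ + μ)) *
        ((∫ s in (x/2)..x, s ^ (-γ + μ) * (2 / (1 - (2:ℝ) ^ (γ - 1))) * j s) +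
         (∫ s in (x/2)..x, s ^ (-γ + 2*μ) * (-c + j s) ^ 2) +
         (1 - γ) * (β - 1 / (1 - γ)) * ∫ s in (0:ℝ)..x, s ^ (-γ + μ) * j s)) :
    let θ : ℝ := (2:ℝ) ^ (γ - 1)
    let h : ℝ → ℝ := fun x => 1 / (1 - θ) + x ^ μ * (-c + j x)
    ∃ z' : ℝ, 0 < z' ∧ z' ≤ z ∧ (∀ x ∈ Set.Ioo 0 z', deriv h x < 0) ∧
      StrictAntiOn h (Set.Ioo 0 z') := by
  intro θ h
  have h1γ : 0 < 1 - γ := by linarith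
  have hβ0 : 0 < β := lt_of_lt_of_le (by positivity) hβ
  set A : ℝ := 2 / (1 - (2:ℝ) ^ (γ - 1)) with hA
  set K : ℝ := (1 - γ) * (β - 1 / (1 - γ)) with hK
  let R : ℝ → ℝ := fun x => -(1 - γ + μ) * j x + (1/β) * ((A * j x
    - (1/2:ℝ) ^ (-γ+μ) * (A * j (x/2)) * (1/2)) + (x ^ μ * (-c + j x)^2
    - x ^ μ * (1/2:ℝ) ^ (-γ+2*μ) * (-c + j (x/2))^2 * (1/2)) + K * j x)
  have hderiv : ∀ x ∈ Set.Ioo 0 z, HasDerivAt h (x ^ (μ-1) * (μ * (-c + j x) + R x)) x := by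
    intro x hx
    have hx0 : 0 < x := hx.1
    have d1 := aux_half_s10 (-γ+μ) z (by linarith) (fun s => A * j s) (by fun_prop) x hx
    have d2 := aux_half_s10 (-γ+2*μ) z (by linarith) (fun s => (-c + j s)^2) (by fun_prop) x hx
    have d3 := aux_deriv (-γ+μ) z (by linarith) j hcont x hx
    have d0 := (Real.hasDerivAt_rpow_const (x := x) (p := -(1-γ+μ)) (Or.inl hx0.ne')).const_mul (1/β)
    have dj := d0.mul ((d1.add d2).add (d3.const_mul K))
    have dj' : HasDerivAt j _ x := dj.congr_of_eventuallyEq (by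
      filter_upwards [isOpen_Ioo.mem_nhds hx] with y hy
      rw [hfix y ⟨hy.1.le, hy.2.le⟩]
      simp only [Pi.mul_apply, Pi.add_apply, mul_assoc])
    have hjx := hfix x ⟨hx.1.le, hx.2.le⟩
    have dh := ((Real.hasDerivAt_rpow_const (x := x) (p := μ) (Or.inl hx0.ne')).mul
      (dj'.const_add (-c))).const_add (1/(1-θ))
    refine dh.congr_deriv ?_
    simp only [Pi.add_apply]
    simp only [mul_assoc] at hjx
    set G := (∫ s in (x/2)..x, s ^ (-γ + μ) * (A * j s)) +
         ((∫ s in (x/2)..x, s ^ (-γ + 2*μ) * (-c + j s) ^ 2)) +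
         K * ∫ s in (0:ℝ)..x, s ^ (-γ + μ) * j s with hG
    have e1 : x ^ (-(1-γ+μ) - 1) = x ^ (-(1-γ+μ)) / x := by
      rw [Real.rpow_sub_one hx0.ne']
    have e2 : x ^ (-(1-γ+μ)) * x ^ (-γ+μ) = x⁻¹ := by
      rw [← Real.rpow_add hx0, ← Real.rpow_neg_one]; congr 1; ring
    have e3 : x ^ (-(1-γ+μ)) * x ^ (-γ+2*μ) = x ^ μ * x⁻¹ := by
      rw [← Real.rpow_neg_one, ← Real.rpow_add hx0, ← Real.rpow_add hx0]; congr 1; ring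
    have e4 : ∀ q : ℝ, (x/2) ^ q = x ^ q * (1/2:ℝ) ^ q := by
      intro q; rw [← Real.mul_rpow hx0.le (by norm_num)]; congr 1; ring
    have e5 : x ^ (μ - 1) = x ^ μ * x⁻¹ := by
      rw [Real.rpow_sub_one hx0.ne']; rfl
    have hjG : j x = (1/β) * (x ^ (-(1-γ+μ)) * G) := by
      rw [hjx, hG]
    rw [e1, e4, e4, e5]
    simp only [R]
    set P := x ^ (-(1-γ+μ))
    set a := x ^ (-γ+μ)
    set b := x ^ (-γ+2*μ)
    set m := x ^ μ
    set jx := j x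
    set k1 := (1/2:ℝ) ^ (-γ+μ)
    set k2 := (1/2:ℝ) ^ (-γ+2*μ)
    set y := j (x/2)
    rw [div_eq_mul_inv P x]
    linear_combination (m * (1-γ+μ) * x⁻¹) * hjG
      + m * (1/β) * (A * jx - k1 * (A*y) * (1/2) + K * jx) * e2
      + m * (1/β) * ((-c+jx)^2 - k2 * (-c+y)^2 * (1/2)) * e3
  have hj : Tendsto j (𝓝[>] 0) (𝓝 0) := by
    have := hcont 0 ⟨le_rfl, hz.le⟩
    rw [ContinuousWithinAt, hj0] at this
    refine this.mono_left ?_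
    rw [← nhdsWithin_Ioo_eq_nhdsGT hz]
    exact nhdsWithin_mono _ Set.Ioo_subset_Icc_self
  have hhalf : Tendsto (fun x : ℝ => x / 2) (𝓝[>] 0) (𝓝[>] 0) := by
    apply tendsto_nhdsWithin_of_tendsto_nhds_of_eventually_within
    · have : Tendsto (fun x : ℝ => x / 2) (𝓝 0) (𝓝 (0/2)) := tendsto_id.div_const 2
      rw [zero_div] at this
      exact this.mono_left nhdsWithin_le_nhds
    · filter_upwards [self_mem_nhdsWithin] with x hx
      exact half_pos (Set.mem_Ioi.1 hx)
  have hj2 : Tendsto (fun x => j (x/2)) (𝓝[>] 0) (𝓝 0) := hj.comp hhalf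
  have hpow : Tendsto (fun x : ℝ => x ^ μ) (𝓝[>] 0) (𝓝 0) := by
    have := (Real.continuousAt_rpow_const 0 μ (Or.inr hμpos.le)).tendsto
    rw [Real.zero_rpow hμpos.ne'] at this
    exact this.mono_left nhdsWithin_le_nhds
  have hlim : Tendsto (fun x => μ * (-c + j x) + R x) (𝓝[>] 0) (𝓝 (-(μ * c))) := by
    have := ((hj.const_add (-c)).const_mul μ).add ((hj.const_mul (-(1-γ+μ))).add
      (((((hj.const_mul A).sub (((hj2.const_mul A).const_mul ((1/2:ℝ) ^ (-γ+μ))).mul_const (1/2))).add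
      ((hpow.mul ((hj.const_add (-c)).pow 2)).sub
        (((hpow.mul_const ((1/2:ℝ) ^ (-γ+2*μ))).mul ((hj2.const_add (-c)).pow 2)).mul_const (1/2)))).add
      (hj.const_mul K)).const_mul (1/β)))
    convert this using 2
    ring
  have hev := hlim.eventually_lt_const (show -(μ*c) < 0 by nlinarith [mul_pos hμpos hc])
  obtain ⟨w, hw, hw'⟩ := mem_nhdsGT_iff_exists_Ioo_subset.1 hev
  have hneg : ∀ x ∈ Set.Ioo 0 (min w z), deriv h x < 0 := by
    intro x hx
    rw [(hderiv x ⟨hx.1, hx.2.trans_le (min_le_right _ _)⟩).deriv]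
    exact mul_neg_of_pos_of_neg (Real.rpow_pos_of_pos hx.1 _)
      (hw' ⟨hx.1, hx.2.trans_le (min_le_left _ _)⟩)
  refine ⟨min w z, lt_min hw hz, min_le_right _ _, hneg, ?_⟩
  apply strictAntiOn_of_deriv_neg (convex_Ioo _ _)
  · intro x hx
    exact (hderiv x ⟨hx.1, hx.2.trans_le (min_le_right _ _)⟩).continuousAt.continuousWithinAt
  · rw [interior_Ioo]; exact hneg
end

section
/- Let γ < 1, θ := 2^{γ−1}, β > 0, and let h be a differentiable solution of −β x h'(x) − h(x) = θ h(x/2)² − h(x)² on an interval containing x₀ > 0 and x₀/2. If 0 < h(x₀) < 1/(1−θ) and h(x₀) < h(x₀/2), then h'(x₀) < 0. Consequently, a solution h of this equation that is positive, strictly decreasing near 0, and satisfies h < 1/(1−θ) remains strictly decreasing as long as it exists and is positive. -/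
open Filter Topology Set

/-- If `h` solves the rescaled equation, `0 < h(x₀) < 1/(1-θ)` and `h(x₀) < h(x₀/2)`,
then `h'(x₀) < 0`. Consequently, a positive solution bounded by `1/(1-θ)` that is
strictly decreasing near `0` is strictly decreasing on all of `(0,∞)`. -/
theorem stmt11 (γ β : ℝ) (hγ : γ < 1) (hβ : 0 < β) :
    let θ : ℝ := (2:ℝ) ^ (γ - 1)
    (∀ (h : ℝ → ℝ) (x₀ : ℝ), 0 < x₀ → DifferentiableAt ℝ h x₀ →
      (-β * x₀ * deriv h x₀ - h x₀ = θ * (h (x₀/2)) ^ 2 - (h x₀) ^ 2) →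
      0 < h x₀ → h x₀ < 1 / (1 - θ) → h x₀ < h (x₀/2) → deriv h x₀ < 0) ∧
    (∀ h : ℝ → ℝ, (∀ x > 0, DifferentiableAt ℝ h x) →
      (∀ x > 0, -β * x * deriv h x - h x = θ * (h (x/2)) ^ 2 - (h x) ^ 2) →
      (∀ x > 0, 0 < h x) → (∀ x > 0, h x < 1 / (1 - θ)) →
      (∃ δ > 0, StrictAntiOn h (Set.Ioo 0 δ)) →
      StrictAntiOn h (Set.Ioi 0)) := by
  intro θ
  have hθ : θ < 1 := Real.rpow_lt_one_of_one_lt_of_neg (by norm_num) (by linarith)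
  have hθ0 : 0 < θ := Real.rpow_pos_of_pos (by norm_num) _
  have part1 : ∀ (h : ℝ → ℝ) (x₀ : ℝ), 0 < x₀ → DifferentiableAt ℝ h x₀ →
      (-β * x₀ * deriv h x₀ - h x₀ = θ * (h (x₀/2)) ^ 2 - (h x₀) ^ 2) →
      0 < h x₀ → h x₀ < 1 / (1 - θ) → h x₀ < h (x₀/2) → deriv h x₀ < 0 := by
    intro h x hx _ he h0 h1 h2
    rw [lt_div_iff₀ (by linarith)] at h1
    have h3 : θ * h x ^ 2 < θ * h (x/2) ^ 2 :=
      mul_lt_mul_of_pos_left (pow_lt_pow_left₀ h2 h0.le (by norm_num)) hθ0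
    have h4 : h x * (h x * (1 - θ)) < h x * 1 := mul_lt_mul_of_pos_left h1 h0
    have h5 : 0 < β * x := mul_pos hβ hx
    by_contra hc
    have h6 := mul_nonneg h5.le (not_lt.mp hc)
    nlinarith
  refine ⟨part1, ?_⟩
  intro h hd he h0 h1 ⟨δ, hδ, hanti⟩
  have key : ∀ x > 0, h x < h (x/2) := by
    by_contra hcon
    push Not at hcon
    obtain ⟨x₁, hx₁, hg⟩ := hcon
    have hcont : ContinuousOn (fun x => h x - h (x/2)) (Icc (δ/2) x₁) := by
      intro x hx
      have hx0 : 0 < x := by linarith [hx.1]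
      have hc1 : ContinuousAt h (x/2) := (hd (x/2) (by positivity)).continuousAt
      have hc2 : ContinuousAt (fun y : ℝ => h (y/2)) x :=
        ContinuousAt.comp (f := fun y : ℝ => y/2) (g := h) hc1 (by fun_prop)
      exact ((hd x hx0).continuousAt.sub hc2).continuousWithinAt
    have hsmall : ∀ x, 0 < x → x < δ → h x < h (x/2) := fun x hx hxd =>
      hanti ⟨by linarith, by linarith⟩ ⟨hx, hxd⟩ (by linarith)
    have hx₁δ : δ ≤ x₁ := by
      by_contra hlt
      exact absurd (hsmall x₁ hx₁ (not_le.mp hlt)) (not_lt.mpr hg)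
    have hclosed : IsCompact (Icc (δ/2) x₁ ∩ (fun x => h x - h (x/2)) ⁻¹' Ici 0) :=
      isCompact_Icc.of_isClosed_subset
        (hcont.preimage_isClosed_of_isClosed isClosed_Icc isClosed_Ici) inter_subset_left
    obtain ⟨c, ⟨hcI, hcg⟩, hmin⟩ := hclosed.exists_isLeast
      ⟨x₁, ⟨by linarith, le_rfl⟩, by simpa using hg⟩
    have hc0 : 0 < c := by linarith [hcI.1]
    have hlow : ∀ x, 0 < x → x < c → h x < h (x/2) := by
      intro x hx hxc
      by_contra hn
      have hxd : δ ≤ x := by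
        by_contra hlt
        exact hn (hsmall x hx (not_le.mp hlt))
      have : c ≤ x := hmin ⟨⟨by linarith, by linarith [hcI.2]⟩, by simpa using not_lt.mp hn⟩
      linarith
    have hA : StrictAntiOn h (Ioc 0 c) := by
      apply strictAntiOn_of_deriv_neg (convex_Ioc 0 c)
      · exact fun x hx => (hd x hx.1).continuousAt.continuousWithinAt
      · intro x hx
        rw [interior_Ioc] at hx
        exact part1 h x hx.1 (hd x hx.1) (he x hx.1) (h0 x hx.1) (h1 x hx.1) (hlow x hx.1 hx.2)
    have := hA (a := c/2) (b := c) ⟨by linarith, by linarith⟩ ⟨hc0, le_rfl⟩ (by linarith)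
    have hcg' : 0 ≤ h c - h (c/2) := hcg
    linarith
  apply strictAntiOn_of_deriv_neg (convex_Ioi 0)
  · exact fun x hx => (hd x hx).continuousAt.continuousWithinAt
  · intro x hx
    rw [interior_Ioi] at hx
    exact part1 h x hx (hd x hx) (he x hx) (h0 x hx) (h1 x hx) (key x hx)
end

section
/- Let γ < 1, β ≥ β_* := 1/(1−γ), and let h : (0,a] → [0,∞) be continuous, satisfy β x^{1−γ} h(x) = ∫_{x/2}^x s^{−γ} h(s)² ds + (1−γ)(β − β_*) ∫_0^x s^{−γ} h(s) ds for all x ∈ (0,a], and suppose lim_{x→0} h(x) = 1/(1−θ) > 0 with θ := 2^{γ−1}. Then h(x) > 0 for all x ∈ (0,a]. -/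
open Filter Topology MeasureTheory Set

/-- A nonnegative continuous solution of the integrated rescaled equation on `(0,a]`
with `h(x) → 1/(1-θ)` as `x → 0⁺` is strictly positive on `(0,a]` (here `β ≥ β*`). -/
theorem stmt12 (γ β a : ℝ) (hγ : γ < 1) (hβ : 1 / (1 - γ) ≤ β) (ha : 0 < a)
    (h : ℝ → ℝ)
    (hcont : ContinuousOn h (Set.Ioc 0 a))
    (hnonneg : ∀ x ∈ Set.Ioc 0 a, 0 ≤ h x)
    (heq : ∀ x ∈ Set.Ioc 0 a, β * x ^ (1 - γ) * h x =
      (∫ s in (x/2)..x, s ^ (-γ) * (h s) ^ 2) +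
        (1 - γ) * (β - 1 / (1 - γ)) * ∫ s in (0:ℝ)..x, s ^ (-γ) * h s)
    (hlim : Tendsto h (𝓝[>] 0) (𝓝 (1 / (1 - (2:ℝ) ^ (γ - 1))))) :
    ∀ x ∈ Set.Ioc 0 a, 0 < h x := by
  have hg : 0 < 1 - γ := by linarith
  have step : ∀ x ∈ Set.Ioc 0 a, h x = 0 → h (x/2) = 0 := by
    intro x hx h0
    obtain ⟨hx0, hxa⟩ := hx
    have e := heq x ⟨hx0, hxa⟩
    rw [h0, mul_zero] at e
    have h2 : 0 ≤ ∫ s in (0:ℝ)..x, s ^ (-γ) * h s := by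
      rw [intervalIntegral.integral_of_le hx0.le]
      refine setIntegral_nonneg measurableSet_Ioc fun s hs => ?_
      exact mul_nonneg (Real.rpow_nonneg hs.1.le _) (hnonneg s ⟨hs.1, hs.2.trans hxa⟩)
    have h3 : 0 ≤ (1 - γ) * (β - 1 / (1 - γ)) * ∫ s in (0:ℝ)..x, s ^ (-γ) * h s :=
      mul_nonneg (mul_nonneg hg.le (by linarith)) h2
    by_contra hne
    have hpos : 0 < ∫ s in (x/2)..x, s ^ (-γ) * (h s) ^ 2 := by
      refine intervalIntegral.integral_pos (by linarith) ?_ ?_ ⟨x/2, ⟨le_refl _, by linarith⟩, ?_⟩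
      · refine ContinuousOn.mul ?_ ((hcont.mono ?_).pow 2)
        · intro s hs
          have : 0 < s := by linarith [hs.1]
          exact (Real.continuousAt_rpow_const s _ (Or.inl this.ne')).continuousWithinAt
        · intro s hs
          exact ⟨by linarith [hs.1], hs.2.trans hxa⟩
      · intro s hs
        have : 0 < s := by linarith [hs.1]
        positivity
      · have : 0 < x / 2 := by linarith
        have := Real.rpow_pos_of_pos this (-γ)
        positivity
    linarith
  intro x hx
  refine lt_of_le_of_ne (hnonneg x hx) fun h0 => ?_
  have hn : ∀ n : ℕ, x * (1/2) ^ n ∈ Set.Ioc 0 a ∧ h (x * (1/2) ^ n) = 0 := by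
    intro n
    induction n with
    | zero => simpa using ⟨hx, h0.symm⟩
    | succ k ih =>
      have hk : x * (1/2:ℝ) ^ (k+1) = x * (1/2) ^ k / 2 := by ring
      rw [hk]
      exact ⟨⟨by linarith [ih.1.1], by linarith [ih.1.1, ih.1.2]⟩, step _ ih.1 ih.2⟩
  have ht : Tendsto (fun n : ℕ => x * (1/2:ℝ) ^ n) atTop (𝓝[>] 0) := by
    refine tendsto_nhdsWithin_iff.2 ⟨?_, Eventually.of_forall fun n => (hn n).1.1⟩
    simpa using (tendsto_pow_atTop_nhds_zero_of_lt_one (r := (1/2:ℝ)) (by norm_num)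
      (by norm_num)).const_mul x
  have hc := hlim.comp ht
  have hz : (h ∘ fun n : ℕ => x * (1/2:ℝ) ^ n) = fun _ => 0 := funext fun n => (hn n).2
  rw [hz] at hc
  have hL := tendsto_nhds_unique hc tendsto_const_nhds
  have hθ : (2:ℝ) ^ (γ - 1) < 1 := Real.rpow_lt_one_of_one_lt_of_neg (by norm_num) (by linarith)
  have : 0 < 1 / (1 - (2:ℝ) ^ (γ - 1)) := one_div_pos.2 (by linarith)
  linarith
end

section
/- Let γ < 1, θ := 2^{γ−1}, β > 0, and let h : (0,∞) → (0, 1/(1−θ)) be a differentiable, strictly decreasing solution of −β x h'(x) − h(x) = θ h(x/2)² − h(x)² on (0,∞). Then lim_{x→∞} h(x) = 0. -/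
open Filter Topology Set

/-- A strictly decreasing solution of the rescaled equation taking values in
`(0, 1/(1-θ))` tends to `0` at infinity. -/
theorem stmt13 (γ β : ℝ) (hγ : γ < 1) (hβ : 0 < β) (h : ℝ → ℝ)
    (hdiff : ∀ x > 0, DifferentiableAt ℝ h x)
    (heq : ∀ x > 0, -β * x * deriv h x - h x =
      (2:ℝ) ^ (γ - 1) * (h (x/2)) ^ 2 - (h x) ^ 2)
    (hpos : ∀ x > 0, 0 < h x)
    (hub : ∀ x > 0, h x < 1 / (1 - (2:ℝ) ^ (γ - 1)))
    (hanti : StrictAntiOn h (Set.Ioi 0)) :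
    Tendsto h atTop (𝓝 0) := by
  have hθ1 : (2:ℝ) ^ (γ - 1) < 1 :=
    Real.rpow_lt_one_of_one_lt_of_neg (by norm_num) (by linarith)
  generalize (2:ℝ) ^ (γ - 1) = θ at *
  have hg : Antitone (fun x : ℝ => h (max x 1)) := by
    intro a b hab
    exact hanti.antitoneOn (mem_Ioi.2 (lt_max_of_lt_right one_pos))
      (mem_Ioi.2 (lt_max_of_lt_right one_pos)) (max_le_max_right 1 hab)
  have hev : (fun x : ℝ => h (max x 1)) =ᶠ[atTop] h := by
    filter_upwards [eventually_ge_atTop 1] with x hx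
    rw [max_eq_left hx]
  obtain ⟨L, hL⟩ : ∃ L, Tendsto h atTop (𝓝 L) :=
    ⟨_, (tendsto_atTop_ciInf hg ⟨0, by
      rintro _ ⟨x, rfl⟩
      exact (hpos _ (lt_max_of_lt_right one_pos)).le⟩).congr' hev⟩
  have hL0 : 0 ≤ L := ge_of_tendsto hL (by
    filter_upwards [eventually_gt_atTop 0] with x hx using (hpos x hx).le)
  have hL1 : L ≤ h 1 := le_of_tendsto hL (by
    filter_upwards [eventually_ge_atTop 1] with x hx
    exact hanti.antitoneOn (mem_Ioi.2 one_pos) (mem_Ioi.2 (by linarith)) hx)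
  rcases hL0.eq_or_lt with h0 | hLpos
  · rwa [h0]
  exfalso
  have hLlt : L * (1 - θ) < 1 := (lt_div_iff₀ (by linarith)).1 (hL1.trans_lt (hub 1 one_pos))
  obtain ⟨c, hc⟩ : ∃ c, c = L * (1 - L * (1 - θ)) := ⟨_, rfl⟩
  have hcpos : 0 < c := hc ▸ mul_pos hLpos (by linarith)
  have hhalf : Tendsto (fun x : ℝ => h (x / 2)) atTop (𝓝 L) :=
    hL.comp (tendsto_id.atTop_div_const (by norm_num))
  have hdbl : Tendsto (fun x : ℝ => h (2 * x)) atTop (𝓝 L) :=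
    hL.comp (tendsto_id.const_mul_atTop (by norm_num))
  have hF : Tendsto (fun x : ℝ => h x + (θ * (h (x / 2)) ^ 2 - (h x) ^ 2)) atTop (𝓝 c) := by
    have := hL.add (((hhalf.pow 2).const_mul θ).sub (hL.pow 2))
    convert this using 2
    rw [hc]; ring
  have hD : Tendsto (fun x : ℝ => h x - h (2 * x)) atTop (𝓝 0) := by
    simpa using hL.sub hdbl
  obtain ⟨N, hN⟩ := eventually_atTop.1 (hF.eventually (lt_mem_nhds (half_lt_self hcpos)))
  obtain ⟨x, hxD, hxN, hx0⟩ := ((hD.eventually (gt_mem_nhds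
    (show (0:ℝ) < c / (4 * β) by positivity))).and
    ((eventually_ge_atTop N).and (eventually_gt_atTop 0))).exists
  obtain ⟨ξ, ⟨h1, h2⟩, h3⟩ := exists_deriv_eq_slope h (show x < 2 * x by linarith)
    (fun y hy => (hdiff y (by linarith [hy.1])).continuousAt.continuousWithinAt)
    (fun y hy => (hdiff y (by linarith [hy.1])).differentiableWithinAt)
  have h4 := hN ξ (by linarith)
  have h5 := heq ξ (by linarith)
  rw [eq_div_iff (by linarith)] at h3
  rw [lt_div_iff₀ (by positivity)] at hxD
  have h6 : c / 2 < β * ξ * (-deriv h ξ) := by linarith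
  have hd : 0 < -deriv h ξ := by
    by_contra hcon
    have : 0 ≤ β * ξ * deriv h ξ := mul_nonneg (by nlinarith) (by linarith)
    linarith
  have h7 : β * ξ * (-deriv h ξ) ≤ β * (2 * x) * (-deriv h ξ) := by gcongr
  have h8 : h x - h (2 * x) = x * (-deriv h ξ) := by linarith
  rw [h8] at hxD
  linarith
end

section
/- Let β > 0 and let h : [1,∞) → (0,∞) be a C¹ function satisfying the differential inequality β x h'(x) + h(x) ≤ h(x)² for all x ≥ 1, with h(1) = 1/2. Then h(x) ≤ 1/(1 + x^{1/β}) for all x ≥ 1. -/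
open Filter Topology Set

/-- Comparison estimate: a positive `C¹` function on `[1,∞)` with
`β x h'(x) + h(x) ≤ h(x)²` and `h(1) = 1/2` satisfies `h(x) ≤ 1/(1 + x^(1/β))`. -/
theorem stmt14 (β : ℝ) (hβ : 0 < β) (h h' : ℝ → ℝ)
    (hpos : ∀ x ≥ (1:ℝ), 0 < h x)
    (hderiv : ∀ x ≥ (1:ℝ), HasDerivWithinAt h (h' x) (Set.Ici 1) x)
    (hcont : ContinuousOn h' (Set.Ici 1))
    (hineq : ∀ x ≥ (1:ℝ), β * x * h' x + h x ≤ (h x) ^ 2)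
    (h1 : h 1 = 1/2) :
    ∀ x ≥ (1:ℝ), h x ≤ 1 / (1 + x ^ (1/β)) := by
  intro x hx
  have key : ∀ y ≥ (1:ℝ), HasDerivWithinAt (fun t => ((h t)⁻¹ - 1) * t ^ (-(1/β)))
      ((-(h' y) / (h y)^2) * y ^ (-(1/β)) + ((h y)⁻¹ - 1) * ((-(1/β)) * y ^ (-(1/β) - 1)))
      (Set.Ici 1) y := by
    intro y hy
    have hy0 : y ≠ 0 := by linarith
    exact (((hderiv y hy).fun_inv (hpos y hy).ne').sub_const 1).mul
      ((Real.hasDerivAt_rpow_const (Or.inl hy0)).hasDerivWithinAt)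
  have mono : MonotoneOn (fun t => ((h t)⁻¹ - 1) * t ^ (-(1/β))) (Set.Ici 1) := by
    apply monotoneOn_of_hasDerivWithinAt_nonneg (convex_Ici 1)
      (fun y hy => (key y hy).continuousWithinAt)
      (fun y hy => (key y (interior_subset hy)).mono interior_subset)
    intro y hy
    have hy1 : (1:ℝ) ≤ y := interior_subset hy
    have hy0 : 0 < y := by linarith
    have hp := hpos y hy1
    have hi := hineq y hy1
    have e : (-(h' y) / (h y)^2) * y ^ (-(1/β)) + ((h y)⁻¹ - 1) * ((-(1/β)) * y ^ (-(1/β) - 1))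
        = y ^ (-(1/β)) * ((h y ^ 2 - (β * y * h' y + h y)) / (β * y * h y ^ 2)) := by
      rw [Real.rpow_sub_one hy0.ne']
      field_simp
      ring
    rw [e]
    have : 0 ≤ h y ^ 2 - (β * y * h' y + h y) := by linarith
    positivity
  have hm := mono (Set.mem_Ici.2 le_rfl) (Set.mem_Ici.2 hx) hx
  have hx0 : 0 < x := by linarith
  have hxp : 0 < x ^ (1/β) := Real.rpow_pos_of_pos hx0 _
  simp only [h1, Real.one_rpow, Real.rpow_neg hx0.le] at hm
  have h2 : x ^ (1/β) ≤ (h x)⁻¹ - 1 := by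
    rw [← div_eq_mul_inv, le_div_iff₀ hxp] at hm
    norm_num at hm ⊢
    linarith
  rw [le_div_iff₀ (by positivity)]
  have hp := hpos x hx
  calc h x * (1 + x ^ (1/β)) ≤ h x * (h x)⁻¹ := by
        apply mul_le_mul_of_nonneg_left _ hp.le
        linarith
    _ = 1 := mul_inv_cancel₀ hp.ne'
end
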